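/- Let n ≥ 4 and let c = (c_1,…,c_m) be a cardinality sequence in CS (i.e. m ≥ 2, 2 ≤ c_1 < ⋯ < c_m ≤ n, and c ≠ (2,3)). For an arc (i,j) ∈ Ã_n, the nonnegativity constraint x_{ij} ≥ 0 defines a facet of P_{0,n-path}^c(D̃_n) if and only if c ≠ (2,n), or c = (2,n), n ≥ 5, and (i,j) is an inner arc (both i and j lie in {1,…,n−1}). -/

import Mathlib

open Finset

/-- The arc set `Ã_n` of the digraph `D̃_n` on the node set `Ñ_n = {0,1,…,n} = Fin (n+1)`:
all arcs `(i,j)` with `i ≠ j`, except those entering `0`, those leaving `n`, and the arc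
`(0,n)`.  This is exactly
`{(0,i),(i,n) : 1 ≤ i ≤ n-1} ∪ {(i,j) : 1 ≤ i,j ≤ n-1, i ≠ j}`. -/
def tA (n : ℕ) : Finset (Fin (n + 1) × Fin (n + 1)) :=
  Finset.univ.filter (fun a => a.1 ≠ a.2 ∧ a.2 ≠ 0 ∧ a.1 ≠ Fin.last n ∧
    ¬(a.1 = 0 ∧ a.2 = Fin.last n))

/-- A simple directed `(0,n)`-path in `D̃_n`, encoded by its arc set: there is an
injective map `f` from `Fin (k+1)` to the nodes with `f 0 = 0` and `f k = n` whose
consecutive pairs are exactly the arcs of `P` (so `P` has `k` arcs). -/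
def IsTildePath (n : ℕ) (P : Finset (Fin (n + 1) × Fin (n + 1))) : Prop :=
  P ⊆ tA n ∧ ∃ (k : ℕ) (f : Fin (k + 1) → Fin (n + 1)), Function.Injective f ∧
    f 0 = 0 ∧ f (Fin.last k) = Fin.last n ∧
    P = Finset.image (fun i : Fin k => (f (Fin.castSucc i), f (Fin.succ i))) Finset.univ

/-- Incidence vector of an arc set. -/
noncomputable def incVec {N : ℕ} (C : Finset (Fin N × Fin N)) : Fin N → Fin N → ℝ :=
  fun i j => if (i, j) ∈ C then 1 else 0

/-- The cardinality constrained path polytope `P_{0,n-path}^c(D̃_n)`: the convex hull of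
the incidence vectors of simple `(0,n)`-paths whose cardinality is `c p` for some `p`. -/
noncomputable def pathPolytope (n : ℕ) {m : ℕ} (c : Fin m → ℕ) :
    Set (Fin (n + 1) → Fin (n + 1) → ℝ) :=
  convexHull ℝ {x | ∃ P, IsTildePath n P ∧ (∃ p, P.card = c p) ∧ x = incVec P}

/-- `x(δ^out(i))` in `D̃_n`. -/
noncomputable def outT (n : ℕ) (x : Fin (n + 1) → Fin (n + 1) → ℝ) (i : Fin (n + 1)) :
    ℝ :=
  ∑ a ∈ (tA n).filter (fun a => a.1 = i), x a.1 a.2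

/-- `x(δ^in(i))` in `D̃_n`. -/
noncomputable def inT (n : ℕ) (x : Fin (n + 1) → Fin (n + 1) → ℝ) (i : Fin (n + 1)) :
    ℝ :=
  ∑ a ∈ (tA n).filter (fun a => a.2 = i), x a.1 a.2

/-- The dimension (of the affine hull) of a subset of a real vector space. -/
noncomputable def adim {V : Type*} [AddCommGroup V] [Module ℝ V] (P : Set V) : ℕ :=
  Module.finrank ℝ (vectorSpan ℝ P)

/-- The valid inequality `f x ≤ b` defines a facet of `P`: it is valid and its face has
dimension `(dim P) - 1`. -/
def IsFacetLE {V : Type*} [AddCommGroup V] [Module ℝ V] (P : Set V) (f : V → ℝ) (b : ℝ) :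
    Prop :=
  (∀ x ∈ P, f x ≤ b) ∧ adim {x ∈ P | f x = b} + 1 = adim P

/-- The valid inequality `f x ≥ b` defines a facet of `P`: it is valid and its face has
dimension `(dim P) - 1`. -/
def IsFacetGE {V : Type*} [AddCommGroup V] [Module ℝ V] (P : Set V) (f : V → ℝ) (b : ℝ) :
    Prop :=
  (∀ x ∈ P, b ≤ f x) ∧ adim {x ∈ P | f x = b} + 1 = adim P

/-- The total weight of the consecutive pairs of a list. -/
def chainSum {α : Type*} (w : α → α → ℝ) : List α → ℝ
  | [] => 0
  | [_] => 0
  | x :: y :: t => w x y + chainSum w (y :: t)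

/-- `l` lists distinct elements of `N`. -/
def ListsIn {α : Type*} (N : Finset α) (l : List α) : Prop :=
  l.Nodup ∧ ∀ x ∈ l, x ∈ N

lemma chainSum_append_cons {α : Type*} (w : α → α → ℝ) (p : List α) (x : α) (q : List α) :
    chainSum w (p ++ x :: q) = chainSum w (p ++ [x]) + chainSum w (x :: q) := by
  induction p with
  | nil => simp [chainSum]
  | cons y p ih =>
    cases p with
    | nil => simp [chainSum]
    | cons z p => simp only [List.cons_append, chainSum] at ih ⊢; rw [ih]; ring

lemma chainSum_eq_of_const {α : Type*} (w : α → α → ℝ) (C : ℝ) (x : α) (l : List α)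
    (h : ∀ p y z q, x :: l = p ++ y :: z :: q → w y z = C) :
    chainSum w (x :: l) = l.length * C := by
  induction l generalizing x with
  | nil => simp [chainSum]
  | cons y l ih =>
    have h₁ := ih y fun p y' z q hp => h (x :: p) y' z q (by simp [hp])
    have h₂ := h [] x y l rfl
    simp only [chainSum, h₁, h₂, List.length_cons]
    push_cast
    ring

/-- If every rotation of a closed list has weight zero, then so has every arc on it. -/
lemma arc_eq_zero_of_rotations {α : Type*} (w : α → α → ℝ) (R : α → α → Prop) (u v : α)
    (t : List α) (hR : (u :: v :: t ++ [u]).IsChain R)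
    (h : ∀ l : List α, l.Perm (u :: v :: t) → l.IsChain R → chainSum w l = 0) :
    w u v = 0 := by
  have rot : ∀ p q, p ++ q = u :: v :: t → chainSum w (q ++ p) = 0 := by
    intro p q hpq
    refine h _ (hpq ▸ List.perm_append_comm) ?_
    rw [← hpq] at hR
    cases p with
    | nil => simpa using (List.isChain_append.1 hR).1
    | cons x p =>
      obtain rfl : x = u := by simpa using (List.cons.inj hpq).1
      rw [List.isChain_split]
      rw [List.append_assoc, List.isChain_append] at hR
      exact ⟨hR.2.1, hR.1⟩
  have arc : ∀ p x y q, u :: v :: t = p ++ x :: y :: q →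
      w x y = chainSum w (u :: v :: t ++ [u]) := by
    intro p x y q hp
    have h₁ := rot (p ++ [x]) (y :: q) (by simp [hp])
    rw [hp]
    cases p with
    | nil =>
      obtain rfl : u = x := by simpa using (List.cons.inj hp).1
      simp only [List.nil_append, List.cons_append, chainSum] at h₁ ⊢
      rw [h₁, add_zero]
    | cons z p =>
      obtain rfl : u = z := by simpa using (List.cons.inj hp).1
      have h₂ : u :: p ++ x :: y :: q ++ [u] = (u :: p) ++ x :: (y :: q ++ [u]) := by simp
      rw [h₂, chainSum_append_cons]
      have h₃ : y :: q ++ (u :: p ++ [x]) = (y :: q) ++ u :: (p ++ [x]) := by simp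
      rw [h₃, chainSum_append_cons] at h₁
      simp only [List.cons_append, chainSum] at h₁ ⊢
      linarith
  have h₁ := chainSum_eq_of_const w _ u (v :: t) arc
  have h₂ := rot [] (u :: v :: t) rfl
  rw [List.append_nil] at h₂
  rw [arc [] u v t rfl]
  rw [h₂] at h₁
  have : ((v :: t).length : ℝ) ≠ 0 := by simp only [List.length_cons]; positivity
  rcases mul_eq_zero.1 h₁.symm with h | h
  · exact absurd h this
  · exact h

lemma chainSum_eq_zero {α : Type*} (w : α → α → ℝ) {N : Finset α} {R : α → α → Prop}
    (hw : ∀ u ∈ N, ∀ v ∈ N, u ≠ v → R u v → w u v = 0) (l : List α) (hl : ListsIn N l)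
    (hR : l.IsChain R) : chainSum w l = 0 := by
  induction l with
  | nil => rfl
  | cons x l ih =>
    cases l with
    | nil => rfl
    | cons y l =>
      obtain ⟨hnd, hm⟩ := hl
      rw [List.isChain_cons_cons] at hR
      have h₁ : x ≠ y := by rintro rfl; simp at hnd
      rw [chainSum, ih ⟨hnd.of_cons, fun z hz => hm z (List.mem_cons_of_mem _ hz)⟩ hR.2,
        hw x (hm x (by simp)) y (hm y (by simp)) h₁ hR.1, add_zero]

lemma exists_listsIn {α : Type*} (N : Finset α) (m : ℕ) (h : m ≤ N.card) :
    ∃ l : List α, ListsIn N l ∧ l.length = m := by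
  refine ⟨N.toList.take m, ⟨N.nodup_toList.sublist (List.take_sublist _ _), ?_⟩, by simpa⟩
  intro x hx
  simpa using List.mem_of_mem_take hx

lemma exists_mem_avoiding {α : Type*} [DecidableEq α] (N : Finset α) (l : List α)
    (h : l.length < N.card) : ∃ x ∈ N, x ∉ l := by
  have : l.toFinset.card < N.card := (List.toFinset_card_le l).trans_lt h
  obtain ⟨x, hx, hx'⟩ := Finset.exists_mem_notMem_of_card_lt_card this
  exact ⟨x, hx, by simpa using hx'⟩

lemma exists_listsIn_avoiding {α : Type*} [DecidableEq α] (N : Finset α) (k : List α) (m : ℕ)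
    (h : m + k.length ≤ N.card) :
    ∃ l : List α, ListsIn N l ∧ (∀ x ∈ k, x ∉ l) ∧ l.length = m := by
  obtain ⟨l, ⟨hnd, hm⟩, hl⟩ := exists_listsIn (N \ k.toFinset) m (by
    have := Finset.le_card_sdiff k.toFinset N
    have := List.toFinset_card_le k
    omega)
  refine ⟨l, ⟨hnd, fun x hx => (Finset.mem_sdiff.1 (hm x hx)).1⟩, fun x hx hxl => ?_, hl⟩
  exact (Finset.mem_sdiff.1 (hm x hxl)).2 (by simpa using hx)

lemma isChain_cons_of_notMem {α : Type*} (i j x : α) (l : List α) (h : j ∉ l) :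
    (x :: l).IsChain (fun x y => ¬(x = i ∧ y = j)) := by
  induction l generalizing x with
  | nil => simp
  | cons y l ih =>
    simp only [List.mem_cons, not_or] at h
    rw [List.isChain_cons_cons]
    exact ⟨fun h' => h.1 h'.2.symm, ih y h.2⟩

lemma isChain_append_of_notMem {α : Type*} (i j x : α) (l : List α) (h : i ∉ l) :
    (l ++ [x]).IsChain (fun x y => ¬(x = i ∧ y = j)) := by
  induction l with
  | nil => simp
  | cons y l ih =>
    simp only [List.mem_cons, not_or] at h
    cases l with
    | nil => simpa using fun h' => absurd h'.symm h.1
    | cons z l =>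
      simp only [List.cons_append] at ih ⊢
      rw [List.isChain_cons_cons]
      exact ⟨fun h' => h.1 h'.1.symm, ih h.2⟩

/-- Every arc `(u, v) ≠ (i, j)` lies on a closed list of any prescribed length that avoids
the arc `(i, j)`. -/
lemma exists_cycle_avoiding {α : Type*} [DecidableEq α] (N : Finset α) (i j : α)
    (hij : i ≠ j) (hi : i ∈ N) (hj : j ∈ N) (s : ℕ) (hs : 3 ≤ s) (hsN : s ≤ N.card)
    (hN : 4 ≤ N.card)
    (u v : α) (hu : u ∈ N) (hv : v ∈ N) (huv : u ≠ v) (hne : ¬(u = i ∧ v = j)) :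
    ∃ t : List α, ListsIn N (u :: v :: t) ∧ (u :: v :: t).length = s ∧
      (u :: v :: t ++ [u]).IsChain (fun x y => ¬(x = i ∧ y = j)) := by
  have build : ∀ p ∈ N, p ≠ u → p ≠ v → ∃ t : List α, ListsIn N (u :: v :: p :: t) ∧
      ListsIn N (u :: v :: (t ++ [p])) ∧ t.length + 3 = s := by
    intro p hp hpu hpv
    obtain ⟨t, ⟨hnd, hm⟩, hav, hl⟩ := exists_listsIn_avoiding N [u, v, p] (s - 3)
      (by simp; omega)
    simp only [List.mem_cons, List.not_mem_nil, or_false, forall_eq_or_imp, forall_eq] at hav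
    refine ⟨t, ⟨?_, ?_⟩, ⟨?_, ?_⟩, by omega⟩
    · simp only [List.nodup_cons, List.mem_cons, not_or]; tauto
    · simp only [List.mem_cons]; rintro x (rfl | rfl | rfl | h) <;> simp_all
    · simp only [List.nodup_cons, List.nodup_append, List.mem_cons, List.mem_append,
        not_or]
      simp_all [eq_comm]
      rintro x hx rfl
      exact hav.2.2 hx
    · simp only [List.mem_cons, List.mem_append]
      rintro x (rfl | rfl | h | rfl | h) <;> simp_all
  by_cases hui : u = i
  · subst hui
    have hvj : v ≠ j := fun h => hne ⟨rfl, h⟩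
    obtain ⟨p, hp, hpl⟩ := exists_mem_avoiding N [u, v] (by simp; omega)
    simp only [List.mem_cons, List.not_mem_nil, or_false, not_or] at hpl
    obtain ⟨t, ht, -, hl⟩ := build p hp hpl.1 hpl.2
    refine ⟨p :: t, ht, by simp; omega, ?_⟩
    simp only [List.cons_append]
    rw [List.isChain_cons_cons]
    exact ⟨fun h => hvj h.2, isChain_append_of_notMem u j u (v :: p :: t)
      (List.nodup_cons.1 ht.1).1⟩
  by_cases hvj : v = j
  · subst hvj
    obtain ⟨p, hp, hpl⟩ := exists_mem_avoiding N [u, v] (by simp; omega)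
    simp only [List.mem_cons, List.not_mem_nil, or_false, not_or] at hpl
    obtain ⟨t, ht, -, hl⟩ := build p hp hpl.1 hpl.2
    refine ⟨p :: t, ht, by simp; omega, ?_⟩
    simp only [List.cons_append]
    rw [List.isChain_cons_cons]
    refine ⟨fun h => hui h.1, isChain_cons_of_notMem i v v (p :: (t ++ [u])) ?_⟩
    have := (List.nodup_cons.1 (List.nodup_cons.1 ht.1).2).1
    simp_all [eq_comm]
  by_cases huj : u = j
  · subst huj
    by_cases hvi : v = i
    · subst hvi
      obtain ⟨p, hp, hpl⟩ := exists_mem_avoiding N [u, v] (by simp; omega)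
      simp only [List.mem_cons, List.not_mem_nil, or_false, not_or] at hpl
      obtain ⟨t, ht, -, hl⟩ := build p hp hpl.1 hpl.2
      refine ⟨p :: t, ht, by simp; omega, ?_⟩
      simp only [List.cons_append]
      rw [List.isChain_cons_cons, List.isChain_cons_cons]
      exact ⟨fun h => hui h.1, fun h => hpl.1 h.2, isChain_append_of_notMem v u u (p :: t)
        (List.nodup_cons.1 (List.nodup_cons.1 ht.1).2).1⟩
    · obtain ⟨p, hp, hpl⟩ := exists_mem_avoiding N [u, v, i] (by simp; omega)
      simp only [List.mem_cons, List.not_mem_nil, or_false, not_or] at hpl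
      obtain ⟨t, -, ht, hl⟩ := build p hp hpl.1 hpl.2.1
      refine ⟨t ++ [p], ht, by simp; omega, ?_⟩
      have h₁ : u :: v :: (t ++ [p]) ++ [u] = (u :: v :: t) ++ p :: [u] := by simp
      rw [h₁, List.isChain_split]
      refine ⟨isChain_cons_of_notMem i u u (v :: t ++ [p]) ?_, by simpa using hpl.2.2⟩
      simpa using (List.nodup_cons.1 ht.1).1
  by_cases hvi : v = i
  · subst hvi
    obtain ⟨p, hp, hpl⟩ := exists_mem_avoiding N [u, v, j] (by simp; omega)
    simp only [List.mem_cons, List.not_mem_nil, or_false, not_or] at hpl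
    obtain ⟨t, ht, -, hl⟩ := build p hp hpl.1 hpl.2.1
    refine ⟨p :: t, ht, by simp; omega, ?_⟩
    simp only [List.cons_append]
    rw [List.isChain_cons_cons, List.isChain_cons_cons]
    exact ⟨fun h => hui h.1, fun h => hpl.2.2 h.2, isChain_append_of_notMem v j u (p :: t)
      (List.nodup_cons.1 (List.nodup_cons.1 ht.1).2).1⟩
  · obtain ⟨t, ht, -, hl⟩ := build j hj (Ne.symm huj) (Ne.symm hvj)
    refine ⟨j :: t, ht, by simp; omega, ?_⟩
    simp only [List.cons_append]
    rw [List.isChain_cons_cons, List.isChain_cons_cons]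
    refine ⟨fun h => hui h.1, fun h => hvi h.1, isChain_cons_of_notMem i j j (t ++ [u]) ?_⟩
    have := (List.nodup_cons.1 (List.nodup_cons.1 (List.nodup_cons.1 ht.1).2).2).1
    simp_all [eq_comm]

lemma ListsIn.perm {α : Type*} {N : Finset α} {l l' : List α} (h : ListsIn N l)
    (hp : l'.Perm l) : ListsIn N l' :=
  ⟨hp.nodup_iff.2 h.1, fun x hx => h.2 x (hp.subset hx)⟩

lemma ListsIn.cons {α : Type*} {N : Finset α} {l : List α} (h : ListsIn N l) {x : α}
    (hx : x ∈ N) (hxl : x ∉ l) : ListsIn N (x :: l) :=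
  ⟨List.nodup_cons.2 ⟨hxl, h.1⟩, by simpa using ⟨hx, h.2⟩⟩

lemma ListsIn.mono {α : Type*} {N M : Finset α} {l : List α} (h : ListsIn N l)
    (hM : ∀ x ∈ l, x ∈ N → x ∈ M) : ListsIn M l :=
  ⟨h.1, fun x hx => hM x hx (h.2 x hx)⟩

lemma arc_eq_zero_inner_one {α : Type*} [DecidableEq α] (N : Finset α)
    (w : α → α → ℝ) (i j : α)
    (hij : i ≠ j) (hi : i ∈ N) (hj : j ∈ N) (s : ℕ) (hs : 3 ≤ s) (hsN : s ≤ N.card)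
    (hN : 4 ≤ N.card)
    (hH : ∀ l, ListsIn N l → l.length = s → l.IsChain (fun x y => ¬(x = i ∧ y = j)) →
      chainSum w l = 0)
    (u v : α) (hu : u ∈ N) (hv : v ∈ N) (huv : u ≠ v) (hne : ¬(u = i ∧ v = j)) :
    w u v = 0 := by
  obtain ⟨t, ht, hl, hc⟩ :=
    exists_cycle_avoiding N i j hij hi hj s hs hsN hN u v hu hv huv hne
  exact arc_eq_zero_of_rotations w _ u v t hc fun l hp hR =>
    hH l (ht.perm hp) (hp.length_eq.trans hl) hR

lemma arc_eq_zero_inner_two {α : Type*} [DecidableEq α] (N : Finset α)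
    (a : α → ℝ) (w : α → α → ℝ) (C : ℝ) (i j : α)
    (hij : i ≠ j) (hi : i ∈ N) (hj : j ∈ N) (s : ℕ) (hs : 3 ≤ s) (hsN : s ≤ N.card)
    (h2 : ∀ u ∈ N, ∀ v ∈ N, u ≠ v → ¬(u = i ∧ v = j) → a u + w u v = C)
    (hH : ∀ v t, ListsIn N (v :: t) → (v :: t).length = s →
      (v :: t).IsChain (fun x y => ¬(x = i ∧ y = j)) → a v + chainSum w (v :: t) = C)
    (u v : α) (hu : u ∈ N) (hv : v ∈ N) (huv : u ≠ v) (hne : ¬(u = i ∧ v = j)) :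
    w u v = 0 := by
  have key : ∀ l, ListsIn N l → l.length + 1 = s →
      l.IsChain (fun x y => ¬(x = i ∧ y = j)) → i ∈ l → chainSum w l = 0 := by
    intro l hl hlen hR hil
    obtain ⟨x, hx, hxl⟩ := exists_mem_avoiding N l (by omega)
    have hxi : x ≠ i := by rintro rfl; exact hxl hil
    cases l with
    | nil => rfl
    | cons y l =>
      have h₁ := hH x (y :: l) (hl.cons hx hxl) (by simpa using hlen)
        (by rw [List.isChain_cons_cons]; exact ⟨fun h => hxi h.1, hR⟩)
      have h₂ := h2 x hx y (hl.2 y (by simp)) (by rintro rfl; simp at hxl) (fun h => hxi h.1)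
      rw [chainSum] at h₁
      linarith
  have cyc : ∀ x ∈ N, ∀ y ∈ N, x ≠ y → (x = i ∨ y = i) → x ≠ j → y ≠ j → w x y = 0 := by
    intro x hx y hy hxy hor hxj hyj
    obtain ⟨t, ht, hav, hl⟩ := exists_listsIn_avoiding (N.erase j) [x, y] (s - 3) (by
      rw [Finset.card_erase_of_mem hj]; simp; omega)
    simp only [List.mem_cons, List.not_mem_nil, or_false, forall_eq_or_imp, forall_eq] at hav
    have hjt : j ∉ t := fun h => by simpa using ht.2 j h
    have hL : ListsIn N (x :: y :: t) :=
      ((ht.mono fun z _ hz => Finset.mem_of_mem_erase hz).cons hy hav.2).cons hx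
        (by simp [hxy, hav.1])
    refine arc_eq_zero_of_rotations w (fun x y => ¬(x = i ∧ y = j)) x y t ?_ ?_
    · refine isChain_cons_of_notMem i j x (y :: t ++ [x]) ?_
      simp_all [eq_comm]
    · intro l hp hR
      refine key l (hL.perm hp) ?_ hR (hp.symm.subset ?_)
      · have := hp.length_eq; simp at this; omega
      · rcases hor with rfl | rfl <;> simp
  have tail : ∀ x ∈ N, ∃ y ∈ N, x ≠ y ∧ ¬(x = i ∧ y = j) ∧ (x ≠ j → w x y = 0) := by
    intro x hx
    by_cases hxi : x = i
    · subst hxi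
      obtain ⟨y, hy, hyl⟩ := exists_mem_avoiding N [x, j] (by simp; omega)
      simp only [List.mem_cons, List.not_mem_nil, or_false, not_or] at hyl
      exact ⟨y, hy, Ne.symm hyl.1, fun h => hyl.2 h.2,
        fun hxj => cyc x hx y hy (Ne.symm hyl.1) (Or.inl rfl) hxj hyl.2⟩
    · exact ⟨i, hi, hxi, fun h => hxi h.1, fun hxj => cyc x hx i hi hxi (Or.inr rfl) hxj hij⟩
  have off : ∀ x ∈ N, ∀ y ∈ N, x ≠ y → ¬(x = i ∧ y = j) → x ≠ j → w x y = 0 := by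
    intro x hx y hy hxy hne hxj
    obtain ⟨z, hz, hxz, hne', h0⟩ := tail x hx
    have h₁ := h2 x hx y hy hxy hne
    have h₂ := h2 x hx z hz hxz hne'
    have h₃ := h0 hxj
    linarith
  by_cases huj : u = j
  · subst huj
    obtain ⟨t, ht, hav, hl⟩ := exists_listsIn_avoiding (N.erase u) [i] (s - 3) (by
      rw [Finset.card_erase_of_mem hj]; simp; omega)
    have hit : i ∉ t := hav i (by simp)
    have hut : u ∉ t := fun h => by simpa using ht.2 u h
    have hL' : ListsIn (N.erase u) (i :: t) := ht.cons (by simp [hij, hi]) hit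
    have hc := isChain_cons_of_notMem i u i t hut
    have h₁ := key (u :: i :: t)
      ((hL'.mono fun z _ hz => Finset.mem_of_mem_erase hz).cons hu (by simp [hut, hij.symm]))
      (by simp; omega) (by rw [List.isChain_cons_cons]; exact ⟨fun h => hij h.1.symm, hc⟩) (by simp)
    have h₂ : chainSum w (i :: t) = 0 := by
      refine chainSum_eq_zero w (N := N.erase u) ?_ _ hL' hc
      intro x hx y hy hxy hne
      rw [Finset.mem_erase] at hx hy
      exact off x hx.2 y hy.2 hxy hne hx.1
    rw [chainSum, h₂] at h₁
    have h₃ := h2 u hu i hi hij.symm (fun h => hij h.1.symm)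
    have h₄ := h2 u hu v hv huv hne
    linarith
  · exact off u hu v hv huv hne huj

lemma arc_eq_zero_outer_one {α : Type*} [DecidableEq α] (N : Finset α)
    (w : α → α → ℝ) (i : α) (hi : i ∈ N) (s : ℕ) (hs : 3 ≤ s) (hsN : s < N.card)
    (hH : ∀ v t, ListsIn N (v :: t) → (v :: t).length = s → v ≠ i →
      chainSum w (v :: t) = 0)
    (u v : α) (hu : u ∈ N) (hv : v ∈ N) (huv : u ≠ v) : w u v = 0 := by
  have off : ∀ u ∈ N, ∀ v ∈ N, u ≠ v → u ≠ i → v ≠ i → w u v = 0 := by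
    intro u hu v hv huv hui hvi
    obtain ⟨t, ht, hav, hl⟩ := exists_listsIn_avoiding N [u, v, i] (s - 2) (by simp; omega)
    simp only [List.mem_cons, List.not_mem_nil, or_false, forall_eq_or_imp, forall_eq] at hav
    refine arc_eq_zero_of_rotations w (fun _ _ => True) u v t ?_ ?_
    · simp [List.isChain_iff_getElem]
    · intro l hp _
      have hL := ((ht.cons hv hav.2.1).cons hu (by simp [huv, hav.1])).perm hp
      have hil : i ∉ l := by
        rw [hp.mem_iff]
        simp [Ne.symm hui, Ne.symm hvi, hav.2.2]
      have hlen := hp.length_eq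
      cases l with
      | nil => rfl
      | cons x l =>
        refine hH x l hL (by simp at hlen ⊢; omega) ?_
        rintro rfl
        simp at hil
  have into : ∀ u ∈ N, u ≠ i → w u i = 0 := by
    intro u hu hui
    obtain ⟨t, ht, hav, hl⟩ := exists_listsIn_avoiding N [u, i] (s - 2) (by simp; omega)
    simp only [List.mem_cons, List.not_mem_nil, or_false, forall_eq_or_imp, forall_eq] at hav
    have hL := ((ht.cons hi hav.2).cons hu (by simp [hui, hav.1])).perm
      (List.perm_append_comm : (t ++ [u, i]).Perm ([u, i] ++ t))
    have h₀ : chainSum w (t ++ [u]) = 0 := by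
      refine chainSum_eq_zero w (N := N.erase i) (R := fun _ _ => True) ?_ _ ?_ ?_
      · intro x hx y hy hxy _
        rw [Finset.mem_erase] at hx hy
        exact off x hx.2 y hy.2 hxy hx.1 hy.1
      · refine (ht.cons hu hav.1).perm (List.perm_append_comm : (t ++ [u]).Perm ([u] ++ t))
          |>.mono fun z hz hzN => ?_
        rw [Finset.mem_erase]
        refine ⟨?_, hzN⟩
        rintro rfl
        simp [hav.2, Ne.symm hui] at hz
      · simp [List.isChain_iff_getElem]
    have h₁ : chainSum w (t ++ [u, i]) = 0 := by
      cases t with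
      | nil => simp at hl; omega
      | cons x t =>
        refine hH x _ hL (by simp at hl ⊢; omega) ?_
        rintro rfl
        simp at hav
    rw [chainSum_append_cons, h₀] at h₁
    simpa [chainSum] using h₁
  by_cases hui : u = i
  · subst hui
    obtain ⟨x, hx, hxl⟩ := exists_mem_avoiding N [u, v] (by simp; omega)
    simp only [List.mem_cons, List.not_mem_nil, or_false, not_or] at hxl
    obtain ⟨t, ht, hav, hl⟩ := exists_listsIn_avoiding N [x, u, v] (s - 3) (by simp; omega)
    simp only [List.mem_cons, List.not_mem_nil, or_false, forall_eq_or_imp, forall_eq] at hav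
    have hLv := ht.cons hv hav.2.2
    have h₁ := hH x (u :: v :: t) ((hLv.cons hu (by simp [huv, hav.2.1])).cons hx
      (by simp [hxl.1, hxl.2, hav.1])) (by simp; omega) hxl.1
    have h₂ : chainSum w (v :: t) = 0 := by
      refine chainSum_eq_zero w (N := N.erase u) (R := fun _ _ => True) ?_ _ ?_ ?_
      · intro x hx y hy hxy _
        rw [Finset.mem_erase] at hx hy
        exact off x hx.2 y hy.2 hxy hx.1 hy.1
      · refine hLv.mono fun z hz hzN => Finset.mem_erase.2 ⟨?_, hzN⟩
        rintro rfl
        simp [hav.2.1, huv] at hz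
      · simp [List.isChain_iff_getElem]
    rw [chainSum, chainSum, h₂, into x hx hxl.1] at h₁
    linarith
  · by_cases hvi : v = i
    · subst hvi; exact into u hu hui
    · exact off u hu v hv huv hui hvi

lemma arc_eq_zero_outer_two {α : Type*} [DecidableEq α] (N : Finset α)
    (a : α → ℝ) (w : α → α → ℝ) (C : ℝ) (i : α) (hi : i ∈ N) (s : ℕ) (hs : 3 ≤ s)
    (hsN : s ≤ N.card)
    (h2 : ∀ u ∈ N, ∀ v ∈ N, u ≠ v → u ≠ i → a u + w u v = C)
    (hH : ∀ v t, ListsIn N (v :: t) → (v :: t).length = s → v ≠ i →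
      a v + chainSum w (v :: t) = C)
    (u v : α) (hu : u ∈ N) (hv : v ∈ N) (huv : u ≠ v) : w u v = 0 := by
  have key : ∀ l, ListsIn N l → l.length + 1 = s → i ∈ l → chainSum w l = 0 := by
    intro l hl hlen hil
    obtain ⟨x, hx, hxl⟩ := exists_mem_avoiding N l (by omega)
    have hxi : x ≠ i := by rintro rfl; exact hxl hil
    cases l with
    | nil => rfl
    | cons y l =>
      have h₁ := hH x (y :: l) (hl.cons hx hxl) (by simpa using hlen) hxi
      have h₂ := h2 x hx y (hl.2 y (by simp)) (by rintro rfl; simp at hxl) hxi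
      rw [chainSum] at h₁
      linarith
  have cyc : ∀ x ∈ N, ∀ y ∈ N, x ≠ y → (x = i ∨ y = i) → w x y = 0 := by
    intro x hx y hy hxy hor
    obtain ⟨t, ht, hav, hl⟩ := exists_listsIn_avoiding N [x, y] (s - 3) (by simp; omega)
    simp only [List.mem_cons, List.not_mem_nil, or_false, forall_eq_or_imp, forall_eq] at hav
    have hL : ListsIn N (x :: y :: t) := (ht.cons hy hav.2).cons hx (by simp [hxy, hav.1])
    refine arc_eq_zero_of_rotations w (fun _ _ => True) x y t ?_ ?_
    · simp [List.isChain_iff_getElem]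
    · intro l hp _
      refine key l (hL.perm hp) ?_ (hp.symm.subset ?_)
      · have := hp.length_eq; simp at this; omega
      · rcases hor with rfl | rfl <;> simp
  by_cases hui : u = i
  · exact cyc u hu v hv huv (Or.inl hui)
  · have h₁ := cyc u hu i hi hui (Or.inr rfl)
    have h₂ := h2 u hu i hi hui hui
    have h₃ := h2 u hu v hv huv hui
    linarith

lemma head_eq_inner {α : Type*} [DecidableEq α] (N : Finset α)
    (a : α → ℝ) (w : α → α → ℝ) (C : ℝ) (i j : α)
    (hj : j ∈ N) (r : ℕ) (hr : 1 ≤ r) (hrN : r < N.card)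
    (hw : ∀ u ∈ N, ∀ v ∈ N, u ≠ v → ¬(u = i ∧ v = j) → w u v = 0)
    (hH : ∀ v t, ListsIn N (v :: t) → (v :: t).length = r →
      (v :: t).IsChain (fun x y => ¬(x = i ∧ y = j)) → a v + chainSum w (v :: t) = C)
    (v : α) (hv : v ∈ N) : a v = C := by
  obtain ⟨t, ht, hvt, hl⟩ := exists_listsIn_avoiding (N.erase j) [v] (r - 1) (by
    rw [Finset.card_erase_of_mem hj]; simp; omega)
  have hL : ListsIn N (v :: t) :=
    (ht.mono fun z _ hz => Finset.mem_of_mem_erase hz).cons hv (hvt v (by simp))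
  have hc := isChain_cons_of_notMem i j v t (fun h => by simpa using ht.2 j h)
  have h₁ := hH v t hL (by simp; omega) hc
  rwa [chainSum_eq_zero w hw _ hL hc, add_zero] at h₁

lemma arc_eq_zero_inner_of_two_le {α : Type*} [DecidableEq α] (w : α → α → ℝ) (i j : α)
    (hij : i ≠ j) (r : ℕ) (hr : 2 ≤ r) :
    ∀ (N : Finset α) (a : α → ℝ) (C : ℝ) (s : ℕ), i ∈ N → j ∈ N → r < s → s ≤ N.card →
    (∀ v t, ListsIn N (v :: t) → ((v :: t).length = r ∨ (v :: t).length = s) →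
      (v :: t).IsChain (fun x y => ¬(x = i ∧ y = j)) → a v + chainSum w (v :: t) = C) →
    ∀ u ∈ N, ∀ v ∈ N, u ≠ v → ¬(u = i ∧ v = j) → w u v = 0 := by
  induction r, hr using Nat.le_induction with
  | base =>
    intro N a C s hi hj hrs hsN hH u hu v hv huv hne
    refine arc_eq_zero_inner_two N a w C i j hij hi hj s hrs hsN ?_
      (fun v t hl hlen hR => hH v t hl (Or.inr hlen) hR) u v hu hv huv hne
    intro u hu v hv huv hne
    have := hH u [v] ⟨by simpa using huv, by simp [hu, hv]⟩ (by simp) (by simpa using hne)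
    simpa [chainSum] using this
  | succ r hr ih =>
    intro N a C s hi hj hrs hsN hH
    have sub : ∀ z ∈ N, z ≠ i → z ≠ j →
        (∀ u ∈ N.erase z, ∀ v ∈ N.erase z, u ≠ v → ¬(u = i ∧ v = j) → w u v = 0) ∧
          ∀ v ∈ N.erase z, a z + w z v = C := by
      intro z hz hzi hzj
      have hi' : i ∈ N.erase z := Finset.mem_erase.2 ⟨hzi.symm, hi⟩
      have hj' : j ∈ N.erase z := Finset.mem_erase.2 ⟨hzj.symm, hj⟩
      have hcard := Finset.card_erase_of_mem hz
      have hH' : ∀ v t, ListsIn (N.erase z) (v :: t) →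
          ((v :: t).length = r ∨ (v :: t).length = s - 1) →
          (v :: t).IsChain (fun x y => ¬(x = i ∧ y = j)) →
          (a z + w z v) + chainSum w (v :: t) = C := by
        intro v t hl hlen hR
        have := hH z (v :: t)
          ((hl.mono fun x _ hx => Finset.mem_of_mem_erase hx).cons hz
            (fun h => by simpa using hl.2 z h))
          (by simp only [List.length_cons] at hlen ⊢; omega)
          (by rw [List.isChain_cons_cons]; exact ⟨fun h => hzi h.1, hR⟩)
        rw [chainSum] at this
        linarith
      have hw := ih (N.erase z) (fun v => a z + w z v) C (s - 1) hi' hj' (by omega)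
        (by omega) hH'
      exact ⟨hw, head_eq_inner (N.erase z) (fun v => a z + w z v) w C i j hj' r
        (by omega) (by omega) hw fun v t hl hlen hR => hH' v t hl (Or.inl hlen) hR⟩
    intro u hu v hv huv hne
    by_cases hu' : u = i ∨ u = j
    · obtain ⟨z, hz, hzl⟩ := exists_mem_avoiding N [i, j, v] (by simp; omega)
      simp only [List.mem_cons, List.not_mem_nil, or_false, not_or] at hzl
      refine (sub z hz hzl.1 hzl.2.1).1 u (Finset.mem_erase.2 ⟨?_, hu⟩) v
        (Finset.mem_erase.2 ⟨Ne.symm hzl.2.2, hv⟩) huv hne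
      rintro rfl
      tauto
    · rw [not_or] at hu'
      obtain ⟨z, hz, hzl⟩ := exists_mem_avoiding N [i, j, u] (by simp; omega)
      simp only [List.mem_cons, List.not_mem_nil, or_false, not_or] at hzl
      have h₁ := (sub z hz hzl.1 hzl.2.1).1 u (Finset.mem_erase.2 ⟨Ne.symm hzl.2.2, hu⟩) i
        (Finset.mem_erase.2 ⟨Ne.symm hzl.1, hi⟩) hu'.1 (fun h => hij h.2)
      have h₂ := (sub u hu hu'.1 hu'.2).2 i (Finset.mem_erase.2 ⟨Ne.symm hu'.1, hi⟩)
      have h₃ := (sub u hu hu'.1 hu'.2).2 v (Finset.mem_erase.2 ⟨Ne.symm huv, hv⟩)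
      linarith

lemma arc_eq_zero_outer_of_two_le {α : Type*} [DecidableEq α] (N : Finset α)
    (a : α → ℝ) (w : α → α → ℝ) (C : ℝ) (i : α) (hi : i ∈ N) (r s : ℕ) (hr : 2 ≤ r)
    (hrs : r < s) (hsN : s ≤ N.card)
    (hH : ∀ v t, ListsIn N (v :: t) → ((v :: t).length = r ∨ (v :: t).length = s) →
      v ≠ i → a v + chainSum w (v :: t) = C)
    (u v : α) (hu : u ∈ N) (hv : v ∈ N) (huv : u ≠ v) : w u v = 0 := by
  rcases hr.eq_or_lt with rfl | hr
  · refine arc_eq_zero_outer_two N a w C i hi s hrs hsN ?_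
      (fun v t hl hlen hvi => hH v t hl (Or.inr hlen) hvi) u v hu hv huv
    intro u hu v hv huv hui
    have := hH u [v] ⟨by simpa using huv, by simp [hu, hv]⟩ (by simp) hui
    simpa [chainSum] using this
  · obtain ⟨z, hz, hzl⟩ := exists_mem_avoiding N [i, u, v] (by simp; omega)
    simp only [List.mem_cons, List.not_mem_nil, or_false, not_or] at hzl
    have hcard := Finset.card_erase_of_mem hz
    have hu' : u ∈ N.erase z := Finset.mem_erase.2 ⟨Ne.symm hzl.2.1, hu⟩
    have hv' : v ∈ N.erase z := Finset.mem_erase.2 ⟨Ne.symm hzl.2.2, hv⟩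
    refine arc_eq_zero_inner_of_two_le w v u huv.symm (r - 1) (by omega) (N.erase z)
      (fun v => a z + w z v) C (s - 1) hv' hu' (by omega) (by omega) ?_ u hu' v hv' huv
      (fun h => huv h.1)
    intro v t hl hlen _
    have := hH z (v :: t)
      ((hl.mono fun x _ hx => Finset.mem_of_mem_erase hx).cons hz
        (fun h => by simpa using hl.2 z h))
      (by simp only [List.length_cons] at hlen ⊢; omega) hzl.1
    rw [chainSum] at this
    linarith

/-- A weighting constant on the lists of two admissible lengths that avoid an inner arc is
trivial off that arc. -/
lemma trivial_off_inner_arc {α : Type*} [DecidableEq α] (N : Finset α)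
    (a : α → ℝ) (w : α → α → ℝ) (C : ℝ) (i j : α) (hij : i ≠ j) (hi : i ∈ N) (hj : j ∈ N)
    (r s : ℕ) (hr : 1 ≤ r) (hs : 3 ≤ s) (hrs : r < s) (hsN : s ≤ N.card)
    (hN : r = 1 → 4 ≤ N.card)
    (hH : ∀ v t, ListsIn N (v :: t) → ((v :: t).length = r ∨ (v :: t).length = s) →
      (v :: t).IsChain (fun x y => ¬(x = i ∧ y = j)) → a v + chainSum w (v :: t) = C) :
    (∀ u ∈ N, ∀ v ∈ N, u ≠ v → ¬(u = i ∧ v = j) → w u v = 0) ∧ ∀ v ∈ N, a v = C := by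
  have hw : ∀ u ∈ N, ∀ v ∈ N, u ≠ v → ¬(u = i ∧ v = j) → w u v = 0 := by
    rcases hr.eq_or_lt with rfl | hr
    · intro u hu v hv huv hne
      refine arc_eq_zero_inner_one N w i j hij hi hj s hs hsN (hN rfl) ?_ u v hu hv huv hne
      intro l hl hlen hR
      cases l with
      | nil => rfl
      | cons x l =>
        have hx := hl.2 x (by simp)
        have h₁ := hH x l hl (Or.inr hlen) hR
        have h₂ := hH x [] ⟨by simp, by simpa using hx⟩ (by simp) (by simp)
        rw [chainSum] at h₂
        linarith
    · exact arc_eq_zero_inner_of_two_le w i j hij r hr N a C s hi hj hrs hsN hH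
  exact ⟨hw, head_eq_inner N a w C i j hj r hr (by omega) hw
    fun v t hl hlen hR => hH v t hl (Or.inl hlen) hR⟩

/-- A weighting constant on the lists of two admissible lengths that do not start at `i` is
trivial off `i`. -/
lemma trivial_off_outer_arc {α : Type*} [DecidableEq α] (N : Finset α)
    (a : α → ℝ) (w : α → α → ℝ) (C : ℝ) (i : α) (hi : i ∈ N)
    (r s : ℕ) (hr : 1 ≤ r) (hs : 3 ≤ s) (hrs : r < s) (hsN : s ≤ N.card)
    (hN : r = 1 → s < N.card)
    (hH : ∀ v t, ListsIn N (v :: t) → ((v :: t).length = r ∨ (v :: t).length = s) →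
      v ≠ i → a v + chainSum w (v :: t) = C) :
    (∀ u ∈ N, ∀ v ∈ N, u ≠ v → w u v = 0) ∧ ∀ v ∈ N, v ≠ i → a v = C := by
  have hw : ∀ u ∈ N, ∀ v ∈ N, u ≠ v → w u v = 0 := by
    intro u hu v hv huv
    rcases hr.eq_or_lt with rfl | hr
    · refine arc_eq_zero_outer_one N w i hi s hs (hN rfl) ?_ u v hu hv huv
      intro x l hl hlen hxi
      have hx := hl.2 x (by simp)
      have h₁ := hH x l hl (Or.inr hlen) hxi
      have h₂ := hH x [] ⟨by simp, by simpa using hx⟩ (by simp) hxi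
      rw [chainSum] at h₂
      linarith
    · exact arc_eq_zero_outer_of_two_le N a w C i hi r s hr hrs hsN hH u v hu hv huv
  refine ⟨hw, fun v hv hvi => ?_⟩
  obtain ⟨t, ht, hvt, hl⟩ := exists_listsIn_avoiding N [v] (r - 1) (by simp; omega)
  have hL := ht.cons hv (hvt v (by simp))
  have h₁ := hH v t hL (by simp; omega) hvi
  rwa [chainSum_eq_zero w (R := fun _ _ => True) (fun u hu v hv huv _ => hw u hu v hv huv) _
    hL (by simp [List.isChain_iff_getElem]), add_zero] at h₁

lemma chainSum_sub_potential {α : Type*} (w : α → α → ℝ) (π : α → ℝ) (x y : α)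
    (t : List α) : chainSum (fun u v => w u v - (π v - π u)) (x :: t ++ [y]) =
      chainSum w (x :: t ++ [y]) - (π y - π x) := by
  induction t generalizing x with
  | nil => simp [chainSum]
  | cons z t ih =>
    have := ih z
    simp only [List.cons_append, chainSum] at this ⊢
    rw [this]
    ring

lemma chainSum_reverse {α : Type*} (w : α → α → ℝ) (l : List α) :
    chainSum w l.reverse = chainSum (fun x y => w y x) l := by
  induction l with
  | nil => rfl
  | cons x l ih =>
    cases l with
    | nil => rfl
    | cons y l =>
      simp only [List.reverse_cons, List.append_assoc, List.cons_append, List.nil_append,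
        chainSum] at ih ⊢
      rw [chainSum_append_cons, ih]
      simp only [chainSum]
      ring

/-- `w` is, off the arc `e`, the difference of a potential on the arcs of the complete digraph
with source `σ`, sink `τ` and inner nodes `N`, and the potential increases by `C`. -/
def IsPotentialOff {α : Type*} (N : Finset α) (σ τ : α) (w : α → α → ℝ) (e : α × α) (C : ℝ)
    (π : α → ℝ) : Prop :=
  π τ - π σ = C ∧ ∀ x y, (x = σ ∨ x ∈ N) → (y = τ ∨ y ∈ N) → x ≠ y → ¬(x = σ ∧ y = τ) →
    (x, y) ≠ e → w x y = π y - π x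

lemma exists_potential_of_trivial {α : Type*} [DecidableEq α] (N : Finset α) (σ τ : α)
    (hσ : σ ∉ N) (hτ : τ ∉ N) (hστ : σ ≠ τ) (w : α → α → ℝ) (e : α × α) (C : ℝ)
    (he : ∀ v ∈ N, e ≠ (v, τ)) (L : List α → Prop) (hL : ∀ l, L l → ListsIn N l)
    (hH : ∀ v t, L (v :: t) → (σ :: (v :: t) ++ [τ]).IsChain (fun x y => (x, y) ≠ e) →
      chainSum w (σ :: (v :: t) ++ [τ]) = C)
    (htriv : ∀ (a : α → ℝ) (w' : α → α → ℝ),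
      (∀ v t, L (v :: t) → (σ :: (v :: t) ++ [τ]).IsChain (fun x y => (x, y) ≠ e) →
        a v + chainSum w' (v :: t) = C) →
      (∀ u ∈ N, ∀ v ∈ N, u ≠ v → (u, v) ≠ e → w' u v = 0) ∧
        ∀ v ∈ N, (σ, v) ≠ e → a v = C) :
    ∃ π, IsPotentialOff N σ τ w e C π := by
  set ρ : α → ℝ := fun x => if x ∈ N then - w x τ else 0 with hρ
  obtain ⟨h₁, h₂⟩ := htriv (fun v => w σ v - ρ v) (fun u v => w u v - (ρ v - ρ u)) (by
    intro v t hl hc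
    have h := hH v t hl hc
    have h₁ := chainSum_sub_potential w ρ σ τ (v :: t)
    rw [h] at h₁
    have hρσ : ρ σ = 0 := by simp [hρ, hσ]
    have hρτ : ρ τ = 0 := by simp [hρ, hτ]
    rw [hρσ, hρτ, List.cons_append, List.cons_append, chainSum] at h₁
    obtain ⟨q, y, hq⟩ : ∃ q y, v :: t = q ++ [y] := by
      have := List.eq_nil_or_concat (v :: t)
      simpa using this
    have hy : y ∈ N := (hL _ hl).2 y (by simp [hq])
    have h₂ : v :: (t ++ [τ]) = q ++ y :: [τ] := by
      rw [← List.cons_append, hq]; simp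
    rw [h₂, chainSum_append_cons, ← hq] at h₁
    have hρy : ρ y = - w y τ := by simp [hρ, hy]
    simp only [chainSum, hρσ, hρτ, hρy] at h₁
    linarith)
  refine ⟨fun x => if x = σ then -C else ρ x, ?_, ?_⟩
  · simp [hστ.symm, hρ, hτ]
  · rintro x y (rfl | hx) (rfl | hy) hxy hne hnee
    · simp at hne
    · have := h₂ y hy hnee
      simp only [hxy.symm, if_true, if_false]
      linarith
    · have : x ≠ σ := by rintro rfl; exact hσ hx
      simp [this, hστ.symm, hρ, hx, hτ]
    · have h₃ : x ≠ σ := by rintro rfl; exact hσ hx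
      have h₄ : y ≠ σ := by rintro rfl; exact hσ hy
      have := h₁ x hx y hy hxy hnee
      simp only [h₃, h₄, if_false]
      linarith

lemma isChain_extend {α : Type*} (R : α → α → Prop) (σ τ v : α) (t : List α)
    (h : (v :: t).IsChain R) (h₁ : R σ v) (h₂ : ∀ x ∈ v :: t, R x τ) :
    (σ :: (v :: t) ++ [τ]).IsChain R := by
  rw [List.cons_append, List.cons_append, List.isChain_cons_cons]
  refine ⟨h₁, ?_⟩
  rw [← List.cons_append, List.isChain_append]
  refine ⟨h, by simp, ?_⟩
  intro x hx y hy
  simp only [List.head?_cons, Option.mem_def, Option.some.injEq] at hy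
  subst hy
  exact h₂ x (List.mem_of_mem_getLast? hx)

/-- A weighting constant on the `σ`-`τ`-paths of two admissible lengths that avoid the arc `e`
comes from a potential off `e`. -/
theorem exists_potential {α : Type*} [DecidableEq α] (N : Finset α) (σ τ : α)
    (hσ : σ ∉ N) (hτ : τ ∉ N) (hστ : σ ≠ τ) (w : α → α → ℝ) (e : α × α) (C : ℝ)
    (r s : ℕ) (hr : 1 ≤ r) (hs : 3 ≤ s) (hrs : r < s) (hsN : s ≤ N.card)
    (he : (e.1 ≠ e.2 ∧ e.1 ∈ N ∧ e.2 ∈ N ∧ (r = 1 → 4 ≤ N.card)) ∨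
      (((e.1 = σ ∧ e.2 ∈ N) ∨ (e.1 ∈ N ∧ e.2 = τ)) ∧ (r = 1 → s < N.card)))
    (hH : ∀ l, ListsIn N l → (l.length = r ∨ l.length = s) →
      (σ :: l ++ [τ]).IsChain (fun x y => (x, y) ≠ e) → chainSum w (σ :: l ++ [τ]) = C) :
    ∃ π, IsPotentialOff N σ τ w e C π := by
  have outer : ∀ (σ τ : α) (_ : σ ∉ N) (_ : τ ∉ N) (_ : σ ≠ τ) (w : α → α → ℝ) (i : α)
      (_ : i ∈ N) (_ : r = 1 → s < N.card)
      (_ : ∀ l, ListsIn N l → (l.length = r ∨ l.length = s) →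
        (σ :: l ++ [τ]).IsChain (fun x y => (x, y) ≠ (σ, i)) →
        chainSum w (σ :: l ++ [τ]) = C),
      ∃ π, IsPotentialOff N σ τ w (σ, i) C π := by
    intro σ τ hσ hτ hστ w i hi hN hH
    refine exists_potential_of_trivial N σ τ hσ hτ hστ w _ C ?_
      (fun l => ListsIn N l ∧ (l.length = r ∨ l.length = s)) (fun l hl => hl.1)
      (fun v t hl hc => hH _ hl.1 hl.2 hc) ?_
    · intro v _ h
      exact hτ ((Prod.mk.inj h).2 ▸ hi)
    · intro a w' h
      have := trivial_off_outer_arc N a w' C i hi r s hr hs hrs hsN hN (by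
        intro v t hl hlen hvi
        have hne : ∀ x ∈ v :: t, x ≠ σ := fun x hx hxσ => hσ (hxσ ▸ hl.2 x hx)
        refine h v t ⟨hl, hlen⟩ (isChain_extend _ σ τ v t ?_ (by simpa using hvi) ?_)
        · rw [List.isChain_iff_getElem]
          intro k hk hxy
          exact hne _ (List.getElem_mem _) (Prod.mk.inj hxy).1
        · intro x hx hxy
          exact hne x hx (Prod.mk.inj hxy).1)
      exact ⟨fun u hu v hv huv _ => this.1 u hu v hv huv,
        fun v hv hne => this.2 v hv fun h => hne (h ▸ rfl)⟩
  rcases he with ⟨hij, hi, hj, hN⟩ | ⟨⟨h₁, hi⟩ | ⟨hi, h₂⟩, hN⟩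
  · obtain ⟨i, j⟩ := e
    refine exists_potential_of_trivial N σ τ hσ hτ hστ w _ C ?_
      (fun l => ListsIn N l ∧ (l.length = r ∨ l.length = s)) (fun l hl => hl.1)
      (fun v t hl hc => hH _ hl.1 hl.2 hc) ?_
    · intro v _ h
      exact hτ ((Prod.mk.inj h).2 ▸ hj)
    · intro a w' h
      have := trivial_off_inner_arc N a w' C i j hij hi hj r s hr hs hrs hsN hN (by
        intro v t hl hlen hR
        refine h v t ⟨hl, hlen⟩ (isChain_extend _ σ τ v t ?_ ?_ ?_)
        · simpa using hR
        · intro hxy; exact hσ ((Prod.mk.inj hxy).1 ▸ hi)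
        · intro x _ hxy; exact hτ ((Prod.mk.inj hxy).2 ▸ hj))
      exact ⟨fun u hu v hv huv hne => this.1 u hu v hv huv (by simpa using hne),
        fun v hv _ => this.2 v hv⟩
  · obtain ⟨i, j⟩ := e
    obtain rfl : i = σ := h₁
    exact outer i τ hσ hτ hστ w j hi hN hH
  · obtain ⟨i, j⟩ := e
    obtain rfl : j = τ := h₂
    obtain ⟨π, hπ, hw⟩ := outer j σ hτ hσ hστ.symm (fun x y => w y x) i hi hN (by
      intro l hl hlen hc
      have hrev : j :: l ++ [σ] = (σ :: l.reverse ++ [j]).reverse := by simp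
      have := hH l.reverse (hl.perm (List.reverse_perm l)) (by simpa using hlen) (by
        rw [hrev, List.isChain_reverse] at hc
        refine hc.imp fun x y hxy => ?_
        simpa [and_comm] using hxy)
      rw [hrev, chainSum_reverse]
      exact this)
    refine ⟨fun x => - π x, by linarith, ?_⟩
    intro x y hx hy hxy hne hnee
    have := hw y x hy hx hxy.symm (fun h => hne h.symm) (by simpa [and_comm] using hnee)
    linarith

/-- The inner nodes of the digraph. -/
def innerNodes (n : ℕ) : Finset (Fin (n + 1)) :=
  (Finset.univ.erase 0).erase (Fin.last n)

lemma mem_innerNodes (n : ℕ) (x : Fin (n + 1)) :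
    x ∈ innerNodes n ↔ x ≠ Fin.last n ∧ x ≠ 0 := by
  simp [innerNodes]

lemma card_innerNodes (n : ℕ) (hn : 1 ≤ n) : (innerNodes n).card = n - 1 := by
  have h : Fin.last n ≠ 0 := by
    intro h
    have := congrArg Fin.val h
    simp at this
    omega
  rw [innerNodes, Finset.card_erase_of_mem (by simp [h]), Finset.card_erase_of_mem (by simp)]
  simp

lemma mem_image_arcs {k N : ℕ} (f : Fin (k + 1) → Fin N) (hf : Function.Injective f)
    (a b : Fin (k + 1)) :
    (f a, f b) ∈ Finset.image (fun t : Fin k => (f t.castSucc, f t.succ)) Finset.univ ↔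
      a.val + 1 = b.val := by
  simp only [Finset.mem_image, Finset.mem_univ, true_and, Prod.mk.injEq, hf.eq_iff]
  constructor
  · rintro ⟨t, rfl, rfl⟩; simp
  · intro h
    have := b.isLt
    exact ⟨⟨a, by omega⟩, by ext; simp, by ext; simpa using h⟩

lemma injective_arcs {k N : ℕ} (f : Fin (k + 1) → Fin N) (hf : Function.Injective f) :
    Function.Injective (fun t : Fin k => (f t.castSucc, f t.succ)) := by
  intro s t h
  exact Fin.castSucc_injective _ (hf (Prod.mk.inj h).1)

lemma chainSum_eq_sum {α : Type*} (w : α → α → ℝ) (x : α) (l : List α) :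
    chainSum w (x :: l) = ∑ t : Fin l.length, w ((x :: l)[t.val]'(by simp; try omega))
      ((x :: l)[t.val + 1]'(by simp)) := by
  induction l generalizing x with
  | nil => simp [chainSum]
  | cons y l ih =>
    rw [chainSum, ih]
    simp only [List.length_cons]
    rw [Fin.sum_univ_succ]
    simp

/-- Every list of distinct inner nodes is the list of inner nodes of a path. -/
lemma exists_path_of_listsIn (n : ℕ) (l : List (Fin (n + 1)))
    (hl : ListsIn (innerNodes n) l) (hne : l ≠ []) :
    ∃ P, IsTildePath n P ∧ P.card = l.length + 1 ∧
      (∀ w : Fin (n + 1) → Fin (n + 1) → ℝ,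
        ∑ a ∈ P, w a.1 a.2 = chainSum w (0 :: l ++ [Fin.last n])) ∧
      (∀ R : Fin (n + 1) → Fin (n + 1) → Prop, (0 :: l ++ [Fin.last n]).IsChain R →
        ∀ a ∈ P, R a.1 a.2) ∧
      ∀ p x y q, 0 :: l ++ [Fin.last n] = p ++ x :: y :: q → (x, y) ∈ P := by
  have h0 : (0 : Fin (n + 1)) ∉ l := fun h => ((mem_innerNodes n 0).1 (hl.2 0 h)).2 rfl
  have hlast : Fin.last n ∉ l := fun h => ((mem_innerNodes n _).1 (hl.2 _ h)).1 rfl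
  have h0last : (0 : Fin (n + 1)) ≠ Fin.last n := by
    obtain ⟨x, t, rfl⟩ := List.exists_cons_of_ne_nil hne
    have hx := (mem_innerNodes n x).1 (hl.2 x (by simp))
    intro h
    have h' := congrArg Fin.val h
    simp at h'
    subst h'
    exact hx.2 (Fin.ext (by have := x.isLt; simp))
  have hnd : (0 :: l ++ [Fin.last n]).Nodup := by
    simp only [List.cons_append, List.nodup_cons, List.nodup_append]
    refine ⟨by simp [h0, h0last], hl.1, by simp, ?_⟩
    rintro a ha b hb rfl
    simp at hb
    exact hlast (hb ▸ ha)
  have hlen : (0 :: l ++ [Fin.last n]).length = l.length + 1 + 1 := by simp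
  obtain ⟨L, hL⟩ : ∃ L, L = 0 :: l ++ [Fin.last n] := ⟨_, rfl⟩
  rw [← hL] at hnd hlen
  have hlt : ∀ t : Fin (l.length + 1 + 1), t.val < L.length := fun t => by
    have := t.isLt
    omega
  have hinj : Function.Injective (fun t : Fin (l.length + 1 + 1) => L[t.val]'(hlt t)) := by
    intro s t h
    exact Fin.ext ((hnd.getElem_inj_iff).1 h)
  have hinj' : Function.Injective (fun t : Fin (l.length + 1) =>
      (L[t.val]'(by omega), L[t.val + 1]'(by omega))) := injective_arcs _ hinj
  have hfirst : L[0]'(by omega) = 0 := by simp [hL]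
  have hfinal : L[l.length + 1]'(by omega) = Fin.last n := by simp [hL]
  refine ⟨Finset.image (fun t : Fin (l.length + 1) =>
    (L[t.val]'(by omega), L[t.val + 1]'(by omega))) Finset.univ, ⟨?_, l.length + 1,
    fun t => L[t.val]'(hlt t), hinj, hfirst, hfinal, rfl⟩, ?_, ?_, ?_, ?_⟩
  · intro a ha
    simp only [Finset.mem_image, Finset.mem_univ, true_and] at ha
    obtain ⟨t, rfl⟩ := ha
    have hidx : ∀ (s t : ℕ) (hs : s < L.length) (ht : t < L.length), L[s] = L[t] → s = t :=
      fun s t hs ht h => (hnd.getElem_inj_iff).1 h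
    simp only [tA, Finset.mem_filter, Finset.mem_univ, true_and]
    refine ⟨fun h => ?_, fun h => ?_, fun h => ?_, fun h => ?_⟩
    · have := hidx _ _ _ _ h; omega
    · have := hidx _ _ _ _ (h.trans hfirst.symm); omega
    · have := hidx _ _ _ _ (h.trans hfinal.symm); omega
    · have h₁ := hidx _ _ _ _ (h.1.trans hfirst.symm)
      have h₂ := hidx _ _ _ _ (h.2.trans hfinal.symm)
      have := List.length_pos_iff.2 hne
      omega
  · rw [Finset.card_image_of_injective _ hinj']
    simp
  · intro w
    rw [Finset.sum_image (fun s _ t _ h => hinj' h)]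
    rw [List.cons_append, chainSum_eq_sum]
    subst hL
    refine Fintype.sum_equiv (finCongr (by simp)) _ _ ?_
    intro t
    simp
  · intro R hR a ha
    rw [← hL, List.isChain_iff_getElem] at hR
    simp only [Finset.mem_image, Finset.mem_univ, true_and] at ha
    obtain ⟨t, rfl⟩ := ha
    exact hR t.val (by omega)
  · intro p x y q hp
    rw [← hL] at hp
    have h₁ : L.length = p.length + (q.length + 1 + 1) := by simp [hp]
    simp only [Finset.mem_image, Finset.mem_univ, true_and]
    refine ⟨⟨p.length, by omega⟩, ?_⟩
    simp [hp]

lemma sum_potential_path (n : ℕ) (P : Finset (Fin (n + 1) × Fin (n + 1)))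
    (hP : IsTildePath n P) (π : Fin (n + 1) → ℝ) :
    ∑ a ∈ P, (π a.2 - π a.1) = π (Fin.last n) - π 0 := by
  obtain ⟨-, k, f, hf, h0, hk, rfl⟩ := hP
  rw [Finset.sum_image (fun s _ t _ h => injective_arcs _ hf h), Finset.sum_sub_distrib]
  have h₁ := Fin.sum_univ_succ (fun t => π (f t))
  have h₂ := Fin.sum_univ_castSucc (fun t => π (f t))
  rw [h0] at h₁
  rw [hk] at h₂
  linarith

lemma linearMap_incVec {N : ℕ} (L : (Fin N → Fin N → ℝ) →ₗ[ℝ] ℝ)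
    (P : Finset (Fin N × Fin N)) :
    L (incVec P) = ∑ a ∈ P, L (Pi.single a.1 (Pi.single a.2 1)) := by
  rw [← map_sum]
  congr 1
  funext x y
  simp only [incVec, Finset.sum_apply]
  have : ∀ a : Fin N × Fin N,
      (Pi.single a.1 (Pi.single a.2 1) : Fin N → Fin N → ℝ) x y = if a = (x, y) then 1 else 0 := by
    rintro ⟨a, b⟩
    by_cases ha : a = x
    · subst ha
      by_cases hb : b = y
      · subst hb; simp
      · simp [hb, Ne.symm hb]
    · simp [ha, Ne.symm ha]
  simp [this]

lemma eq_zero_on_vectorSpan {V : Type*} [AddCommGroup V] [Module ℝ V] (S : Set V)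
    (L : V →ₗ[ℝ] ℝ) (C : ℝ) (h : ∀ x ∈ S, L x = C) : ∀ v ∈ vectorSpan ℝ S, L v = 0 := by
  have : vectorSpan ℝ S ≤ LinearMap.ker L := by
    rw [vectorSpan_def, Submodule.span_le]
    rintro _ ⟨x, hx, y, hy, rfl⟩
    simp [h x hx, h y hy]
  exact fun v hv => this hv

/-- If every linear functional vanishing on the directions of a face is, on the directions of
the whole set, a multiple of the functional defining the face, then the face is a facet. -/
lemma adim_face_add_one {V : Type*} [AddCommGroup V] [Module ℝ V] [FiniteDimensional ℝ V]
    (P F : Set V) (hFP : F ⊆ P) (e : V →ₗ[ℝ] ℝ) (hF : ∀ x ∈ F, e x = 0)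
    (x₀ x₁ : V) (hx₀ : x₀ ∈ F) (hx₁ : x₁ ∈ P) (he : e x₁ ≠ 0)
    (h : ∀ L : V →ₗ[ℝ] ℝ, (∀ v ∈ vectorSpan ℝ F, L v = 0) →
      ∃ c : ℝ, ∀ v ∈ vectorSpan ℝ P, L v = c * e v) :
    adim F + 1 = adim P := by
  have hker : vectorSpan ℝ F = vectorSpan ℝ P ⊓ LinearMap.ker e := by
    apply le_antisymm
    · exact le_inf (vectorSpan_mono ℝ hFP) (eq_zero_on_vectorSpan F e 0 hF)
    · rintro v ⟨hv, hev⟩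
      by_contra hvF
      obtain ⟨L, hL, hLF⟩ := Submodule.exists_le_ker_of_notMem hvF
      obtain ⟨c, hc⟩ := h L (fun v hv => hLF hv)
      apply hL
      rw [hc v hv, LinearMap.mem_ker.1 hev, mul_zero]
  have hd : x₁ - x₀ ∈ vectorSpan ℝ P := vsub_mem_vectorSpan ℝ hx₁ (hFP hx₀)
  have hsurj : LinearMap.range (e.domRestrict (vectorSpan ℝ P)) = ⊤ := by
    rw [LinearMap.range_eq_top]
    intro y
    refine ⟨(y / e x₁) • ⟨x₁ - x₀, hd⟩, ?_⟩
    simp [hF x₀ hx₀, he]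
  have hdim := LinearMap.finrank_range_add_finrank_ker (e.domRestrict (vectorSpan ℝ P))
  rw [hsurj, finrank_top, Module.finrank_self] at hdim
  have hmap : (LinearMap.ker (e.domRestrict (vectorSpan ℝ P))).map
      (vectorSpan ℝ P).subtype = vectorSpan ℝ F := by
    rw [hker]
    ext v
    simp only [Submodule.mem_map, LinearMap.mem_ker, Submodule.mem_inf]
    constructor
    · rintro ⟨⟨y, hy⟩, h₁, rfl⟩; exact ⟨hy, h₁⟩
    · rintro ⟨h₁, h₂⟩; exact ⟨⟨v, h₁⟩, h₂, rfl⟩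
  have hfin := Submodule.finrank_map_subtype_eq (vectorSpan ℝ P)
    (LinearMap.ker (e.domRestrict (vectorSpan ℝ P)))
  rw [hmap] at hfin
  rw [adim, adim, hfin]
  omega

/-- A face on which a further, independent functional is constant is not a facet. -/
lemma adim_face_add_one_ne {V : Type*} [AddCommGroup V] [Module ℝ V] [FiniteDimensional ℝ V]
    (P F : Set V) (hFP : F ⊆ P) (e g : V →ₗ[ℝ] ℝ) (C D : ℝ)
    (hF : ∀ x ∈ F, e x = C) (hg : ∀ x ∈ F, g x = D) (x₀ x₁ x₂ : V)
    (hx₀ : x₀ ∈ P) (hx₁ : x₁ ∈ P) (hx₂ : x₂ ∈ P)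
    (he : e x₁ ≠ e x₀) (he' : e x₁ = e x₂) (hg' : g x₁ ≠ g x₂) :
    adim F + 1 ≠ adim P := by
  have h₁ : vectorSpan ℝ F < vectorSpan ℝ P ⊓ LinearMap.ker e := by
    refine lt_of_le_of_ne
      (le_inf (vectorSpan_mono ℝ hFP) (eq_zero_on_vectorSpan F e C hF)) fun h => hg' ?_
    have : x₁ - x₂ ∈ vectorSpan ℝ F := by
      rw [h]
      exact ⟨vsub_mem_vectorSpan ℝ hx₁ hx₂, by simp [he']⟩
    have := eq_zero_on_vectorSpan F g D hg _ this
    rw [map_sub] at this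
    linarith
  have h₂ : vectorSpan ℝ P ⊓ LinearMap.ker e < vectorSpan ℝ P := by
    refine lt_of_le_of_ne inf_le_left fun h => he ?_
    have : x₁ - x₀ ∈ vectorSpan ℝ P ⊓ LinearMap.ker e := by
      rw [h]
      exact vsub_mem_vectorSpan ℝ hx₁ hx₀
    have := this.2
    simp only [SetLike.mem_coe, LinearMap.mem_ker, map_sub] at this
    linarith
  have h₃ := Submodule.finrank_lt_finrank_of_lt h₁
  have h₄ := Submodule.finrank_lt_finrank_of_lt h₂
  rw [adim, adim]
  omega

/-- The coordinate of the arc `(a, b)`. -/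
def arcCoord {N : ℕ} (a b : Fin N) : (Fin N → Fin N → ℝ) →ₗ[ℝ] ℝ :=
  LinearMap.proj b ∘ₗ LinearMap.proj a

@[simp]
lemma arcCoord_apply {N : ℕ} (a b : Fin N) (x : Fin N → Fin N → ℝ) :
    arcCoord a b x = x a b := rfl

lemma incVec_mem_pathPolytope {n m : ℕ} (c : Fin m → ℕ)
    {P : Finset (Fin (n + 1) × Fin (n + 1))} (hP : IsTildePath n P) {p : Fin m}
    (hp : P.card = c p) : incVec P ∈ pathPolytope n c :=
  subset_convexHull ℝ _ ⟨P, hP, ⟨p, hp⟩, rfl⟩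

lemma le_on_pathPolytope {n m : ℕ} (c : Fin m → ℕ)
    (L : (Fin (n + 1) → Fin (n + 1) → ℝ) →ₗ[ℝ] ℝ) (D : ℝ)
    (h : ∀ P, IsTildePath n P → (∃ p, P.card = c p) → D ≤ L (incVec P)) :
    ∀ x ∈ pathPolytope n c, D ≤ L x := by
  have : pathPolytope n c ⊆ {x | D ≤ L x} := by
    refine convexHull_min ?_ (convex_halfSpace_ge L.isLinear D)
    rintro x ⟨P, hP, hp, rfl⟩
    exact h P hP hp
  exact fun x hx => this hx

lemma eq_on_pathPolytope {n m : ℕ} (c : Fin m → ℕ)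
    (L : (Fin (n + 1) → Fin (n + 1) → ℝ) →ₗ[ℝ] ℝ) (D : ℝ)
    (h : ∀ P, IsTildePath n P → (∃ p, P.card = c p) → L (incVec P) = D) :
    ∀ x ∈ pathPolytope n c, L x = D := by
  intro x hx
  have h₁ := le_on_pathPolytope c L D (fun P hP hp => (h P hP hp).ge) x hx
  have h₂ := le_on_pathPolytope c (-L) (-D) (fun P hP hp => by simp [h P hP hp]) x hx
  rw [LinearMap.neg_apply] at h₂
  linarith

lemma incVec_nonneg {N : ℕ} (P : Finset (Fin N × Fin N)) (a b : Fin N) :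
    0 ≤ incVec P a b := by
  rw [incVec]
  split_ifs <;> norm_num

lemma mem_tA (n : ℕ) (i j : Fin (n + 1)) : (i, j) ∈ tA n ↔
    i ≠ j ∧ (i = 0 ∨ i ∈ innerNodes n) ∧ (j = Fin.last n ∨ j ∈ innerNodes n) ∧
      ¬(i = 0 ∧ j = Fin.last n) := by
  simp only [tA, Finset.mem_filter, Finset.mem_univ, true_and, mem_innerNodes]
  by_cases h : Fin.last n = 0
  · have : ∀ x : Fin (n + 1), x = 0 := by
      intro x
      have h' := congrArg Fin.val h
      simp at h'
      have := x.isLt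
      exact Fin.ext (by simp; omega)
    simp [this i, this j]
  · constructor
    · rintro ⟨h₁, h₂, h₃, h₄⟩; tauto
    · rintro ⟨h₁, rfl | h₂, rfl | h₃, h₄⟩
      · tauto
      · exact ⟨h₁, h₃.2, fun h' => h h'.symm, h₄⟩
      · exact ⟨h₁, h, h₂.1, h₄⟩
      · exact ⟨h₁, h₃.2, h₂.1, h₄⟩

lemma exists_path_avoiding_node (n : ℕ) (u : Fin (n + 1)) (hu : u ∈ innerNodes n) (r : ℕ)
    (hr : 1 ≤ r) (hrn : r + 2 ≤ n) :
    ∃ P, IsTildePath n P ∧ P.card = r + 1 ∧ ∀ a ∈ P, a.1 ≠ u ∧ a.2 ≠ u := by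
  have hu' := (mem_innerNodes n u).1 hu
  obtain ⟨l, hl, hul, hlen⟩ := exists_listsIn_avoiding (innerNodes n) [u] r (by
    rw [card_innerNodes n (by omega)]; simp; omega)
  obtain ⟨P, hP, hcard, -, hR, -⟩ := exists_path_of_listsIn n l hl (by
    rintro rfl; simp at hlen; omega)
  refine ⟨P, hP, by omega, hR (fun x y => x ≠ u ∧ y ≠ u) ?_⟩
  have hmem : ∀ x ∈ 0 :: l ++ [Fin.last n], x ≠ u := by
    intro x hx hxu
    subst hxu
    simp [hu'.1, hu'.2, hul x (by simp)] at hx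
  rw [List.isChain_iff_getElem]
  exact fun k hk => ⟨hmem _ (List.getElem_mem _), hmem _ (List.getElem_mem _)⟩

lemma exists_path_through_arc (n : ℕ) (i j : Fin (n + 1)) (hij : (i, j) ∈ tA n) (s : ℕ)
    (hs : 2 ≤ s ∨ (1 ≤ s ∧ (i = 0 ∨ j = Fin.last n))) (hsn : s + 1 ≤ n) :
    ∃ P, IsTildePath n P ∧ P.card = s + 1 ∧ (i, j) ∈ P := by
  have hcard := card_innerNodes n (by omega)
  have finish : ∀ l, ListsIn (innerNodes n) l → l.length = s →
      (∃ p q, 0 :: l ++ [Fin.last n] = p ++ i :: j :: q) →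
      ∃ P, IsTildePath n P ∧ P.card = s + 1 ∧ (i, j) ∈ P := by
    rintro l hl hlen ⟨p, q, hpq⟩
    obtain ⟨P, hP, hcard, -, -, hmem⟩ := exists_path_of_listsIn n l hl (by
      rintro rfl; simp at hlen; omega)
    exact ⟨P, hP, by omega, hmem p i j q hpq⟩
  obtain ⟨hne, hi, hj, hnot⟩ := (mem_tA n i j).1 hij
  rcases hi with rfl | hi
  · have hj : j ∈ innerNodes n := hj.resolve_left fun h => hnot ⟨rfl, h⟩
    obtain ⟨t, ht, hav, hlen⟩ := exists_listsIn_avoiding (innerNodes n) [j] (s - 1) (by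
      simp; omega)
    exact finish (j :: t) (ht.cons hj (hav j (by simp))) (by simp; omega)
      ⟨[], t ++ [Fin.last n], by simp⟩
  rcases hj with rfl | hj
  · obtain ⟨t, ht, hav, hlen⟩ := exists_listsIn_avoiding (innerNodes n) [i] (s - 1) (by
      simp; omega)
    exact finish (t ++ [i]) ((ht.cons hi (hav i (by simp))).perm
      (List.perm_append_comm : (t ++ [i]).Perm ([i] ++ t))) (by simp; omega)
      ⟨0 :: t, [], by simp⟩
  · have hs2 : 2 ≤ s := by
      rcases hs with hs | ⟨-, rfl | rfl⟩
      · exact hs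
      · exact absurd rfl ((mem_innerNodes n _).1 hi).2
      · exact absurd rfl ((mem_innerNodes n _).1 hj).1
    obtain ⟨t, ht, hav, hlen⟩ := exists_listsIn_avoiding (innerNodes n) [i, j] (s - 2) (by
      simp; omega)
    exact finish (i :: j :: t) ((ht.cons hj (hav j (by simp))).cons hi
      (by simp [hne, hav i (by simp)])) (by simp; omega) ⟨[0], t ++ [Fin.last n], by simp⟩

lemma exists_inner_endpoint (n : ℕ) (i j : Fin (n + 1)) (hij : (i, j) ∈ tA n) :
    ∃ u ∈ innerNodes n, u = i ∨ u = j := by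
  obtain ⟨-, hi, hj, hnot⟩ := (mem_tA n i j).1 hij
  rcases hi with rfl | hi
  · exact ⟨j, hj.resolve_left fun h => hnot ⟨rfl, h⟩, Or.inr rfl⟩
  · exact ⟨i, hi, Or.inl rfl⟩

/-- Two suitable admissible cardinalities suffice for `x i j ≥ 0` to define a facet. -/
theorem isFacetGE_of_two_lengths {n m : ℕ} (hn : 4 ≤ n) (c : Fin m → ℕ) (i j : Fin (n + 1))
    (hij : (i, j) ∈ tA n) (r s : ℕ) (hr : 1 ≤ r) (hs : 3 ≤ s) (hrs : r < s) (hsn : s + 1 ≤ n)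
    (hcr : ∃ p, c p = r + 1) (hcs : ∃ p, c p = s + 1)
    (hlen : r = 1 → (i ≠ 0 ∧ j ≠ Fin.last n ∧ 5 ≤ n) ∨ s + 2 ≤ n) :
    IsFacetGE (pathPolytope n c) (fun x => x i j) 0 := by
  obtain ⟨pr, hpr⟩ := hcr
  obtain ⟨ps, hps⟩ := hcs
  have hcard := card_innerNodes n (by omega)
  refine ⟨le_on_pathPolytope c (arcCoord i j) 0 fun P _ _ => incVec_nonneg P i j, ?_⟩
  obtain ⟨u, hu, huij⟩ := exists_inner_endpoint n i j hij
  obtain ⟨P₀, hP₀, hcard₀, hav₀⟩ := exists_path_avoiding_node n u hu r hr (by omega)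
  obtain ⟨P₁, hP₁, hcard₁, hmem₁⟩ := exists_path_through_arc n i j hij s (by omega) hsn
  have hnot₀ : (i, j) ∉ P₀ := by
    intro h
    have := hav₀ _ h
    rcases huij with rfl | rfl
    · exact this.1 rfl
    · exact this.2 rfl
  have hx₀ : incVec P₀ ∈ {x ∈ pathPolytope n c | x i j = 0} :=
    ⟨incVec_mem_pathPolytope c hP₀ (hcard₀.trans hpr.symm), by simp [incVec, hnot₀]⟩
  refine adim_face_add_one _ _ (fun x hx => hx.1) (arcCoord i j) (fun x hx => hx.2)
    (incVec P₀) (incVec P₁) hx₀ (incVec_mem_pathPolytope c hP₁ (hcard₁.trans hps.symm))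
    (by simp [incVec, hmem₁]) ?_
  intro L hL
  obtain ⟨w, hw⟩ : ∃ w : Fin (n + 1) → Fin (n + 1) → ℝ,
      ∀ a b, w a b = L (Pi.single a (Pi.single b 1)) := ⟨_, fun _ _ => rfl⟩
  have hLP : ∀ P, L (incVec P) = ∑ a ∈ P, w a.1 a.2 := by
    intro P
    simp only [hw]
    exact linearMap_incVec L P
  obtain ⟨hne, hi, hj, hnot⟩ := (mem_tA n i j).1 hij
  have h0 : (0 : Fin (n + 1)) ∉ innerNodes n := fun h => ((mem_innerNodes n _).1 h).2 rfl
  have hlast : Fin.last n ∉ innerNodes n := fun h => ((mem_innerNodes n _).1 h).1 rfl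
  obtain ⟨π, hπ, hwπ⟩ := exists_potential (innerNodes n) 0 (Fin.last n) h0 hlast
    (by intro h; have := congrArg Fin.val h; simp at this; omega)
    w (i, j) (L (incVec P₀)) r s hr hs hrs (by omega) (by
      rcases hi with rfl | hi
      · exact Or.inr ⟨Or.inl ⟨rfl, hj.resolve_left fun h => hnot ⟨rfl, h⟩⟩, fun h => by
          rcases hlen h with h | h
          · exact absurd rfl h.1
          · omega⟩
      · rcases hj with rfl | hj
        · exact Or.inr ⟨Or.inr ⟨hi, rfl⟩, fun h => by
            rcases hlen h with h | h
            · exact absurd rfl h.2.1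
            · omega⟩
        · exact Or.inl ⟨hne, hi, hj, fun h => by have := hlen h; omega⟩) (by
      intro l hl hllen hc
      obtain ⟨P, hP, hPcard, hsum, hR, -⟩ := exists_path_of_listsIn n l hl (by
        rintro rfl; simp at hllen; omega)
      rw [← hsum, ← hLP]
      have hnotP : (i, j) ∉ P := fun h => hR (fun x y => (x, y) ≠ (i, j)) hc _ h rfl
      have hp : ∃ p, P.card = c p := by
        rcases hllen with h | h
        · exact ⟨pr, by omega⟩
        · exact ⟨ps, by omega⟩
      obtain ⟨p, hp⟩ := hp
      have hPF : incVec P ∈ {x ∈ pathPolytope n c | x i j = 0} :=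
        ⟨incVec_mem_pathPolytope c hP hp, by simp [incVec, hnotP]⟩
      have := hL _ (vsub_mem_vectorSpan ℝ hPF hx₀)
      rw [vsub_eq_sub, map_sub] at this
      linarith)
  refine ⟨w i j - (π j - π i), fun v hv => ?_⟩
  have hconst : ∀ x ∈ pathPolytope n c,
      (L - (w i j - (π j - π i)) • arcCoord i j) x = L (incVec P₀) := by
    refine eq_on_pathPolytope c _ _ fun P hP _ => ?_
    have hsum := sum_potential_path n P hP π
    have hsplit : ∀ a ∈ P, w a.1 a.2 = (π a.2 - π a.1) +
        if a = (i, j) then w i j - (π j - π i) else 0 := by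
      rintro ⟨a, b⟩ hab
      split_ifs with h
      · obtain ⟨rfl, rfl⟩ := Prod.mk.inj h
        ring
      · obtain ⟨h₁, h₂, h₃, h₄⟩ := (mem_tA n a b).1 (hP.1 hab)
        rw [add_zero]
        exact hwπ a b h₂ h₃ h₁ h₄ h
    rw [LinearMap.sub_apply, LinearMap.smul_apply, hLP, Finset.sum_congr rfl hsplit,
      Finset.sum_add_distrib, hsum, hπ, Finset.sum_ite_eq']
    simp only [arcCoord_apply, incVec, smul_eq_mul]
    split_ifs <;> ring
  have := eq_zero_on_vectorSpan _ _ _ hconst v hv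
  simp only [LinearMap.sub_apply, LinearMap.smul_apply, smul_eq_mul] at this
  linarith

lemma sum_incVec {N : ℕ} (P : Finset (Fin N × Fin N)) :
    ∑ a, ∑ b, incVec P a b = P.card := by
  rw [← Fintype.sum_prod_type' (f := fun a b => incVec P a b)]
  simp [incVec]

/-- A path of cardinality `n` leaves every inner node. -/
lemma sum_incVec_out_of_card_eq (n : ℕ) (P : Finset (Fin (n + 1) × Fin (n + 1)))
    (hP : IsTildePath n P) (hcard : P.card = n) (u : Fin (n + 1)) (hu : u ∈ innerNodes n) :
    ∑ b, incVec P u b = 1 := by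
  obtain ⟨-, k, f, hf, h0, hk, rfl⟩ := hP
  rw [Finset.card_image_of_injective _ (injective_arcs _ hf), Finset.card_univ,
    Fintype.card_fin] at hcard
  subst hcard
  have hsurj := Finite.injective_iff_surjective.1 hf
  obtain ⟨t, rfl⟩ := hsurj u
  have ht : t ≠ Fin.last k := by
    rintro rfl
    exact ((mem_innerNodes k _).1 hu).1 hk
  have htlt : t.val < k := Fin.val_lt_last ht
  rw [Finset.sum_eq_single (f ⟨t.val + 1, by omega⟩)]
  · rw [incVec, if_pos ((mem_image_arcs f hf _ _).2 rfl)]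
  · intro b _ hb
    obtain ⟨s, rfl⟩ := hsurj b
    rw [incVec, if_neg]
    rw [mem_image_arcs f hf]
    intro h
    exact hb (congrArg f (Fin.ext h.symm))
  · simp

/-- A path of cardinality two visits a single node between its terminals. -/
lemma mem_path_of_card_eq_two (n : ℕ) (P : Finset (Fin (n + 1) × Fin (n + 1)))
    (hP : IsTildePath n P) (hcard : P.card = 2) :
    ∃ v, v ≠ 0 ∧ P = {(0, v), (v, Fin.last n)} := by
  obtain ⟨-, k, f, hf, h0, hk, rfl⟩ := hP
  rw [Finset.card_image_of_injective _ (injective_arcs _ hf), Finset.card_univ,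
    Fintype.card_fin] at hcard
  subst hcard
  refine ⟨f 1, fun h => ?_, ?_⟩
  · have := hf (h.trans h0.symm)
    simp at this
  · have h₁ : Finset.univ = ({0, 1} : Finset (Fin 2)) := by decide
    rw [h₁, Finset.image_insert, Finset.image_singleton, ← hk, ← h0]
    rfl

/-- For `c = (2, n)` the nonnegativity constraints of outer arcs do not define facets. -/
theorem not_isFacetGE_outer {n m : ℕ} (hn : 4 ≤ n) (c : Fin m → ℕ)
    (hc : Set.range c = {2, n}) (i j : Fin (n + 1)) (hij : (i, j) ∈ tA n)
    (hout : i = 0 ∨ j = Fin.last n) :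
    ¬IsFacetGE (pathPolytope n c) (fun x => x i j) 0 := by
  rintro ⟨-, hdim⟩
  obtain ⟨p₂, hp₂⟩ : ∃ p, c p = 2 := by
    have : (2 : ℕ) ∈ Set.range c := by simp [hc]
    exact this
  obtain ⟨pn, hpn⟩ : ∃ p, c p = n := by
    have : n ∈ Set.range c := by simp [hc]
    exact this
  have hcp : ∀ p, c p = 2 ∨ c p = n := by
    intro p
    have : c p ∈ Set.range c := ⟨p, rfl⟩
    rw [hc] at this
    simpa using this
  obtain ⟨u, hu, huij⟩ := exists_inner_endpoint n i j hij
  have hu' := (mem_innerNodes n u).1 hu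
  have harc : (i = 0 ∧ j = u) ∨ (i = u ∧ j = Fin.last n) := by
    rcases hout with rfl | rfl
    · exact Or.inl ⟨rfl, (huij.resolve_left hu'.2).symm⟩
    · exact Or.inr ⟨(huij.resolve_right hu'.1).symm, rfl⟩
  have hn' : (n : ℝ) - 2 ≠ 0 := by
    have : (4 : ℝ) ≤ n := by exact_mod_cast hn
    linarith
  set g : (Fin (n + 1) → Fin (n + 1) → ℝ) →ₗ[ℝ] ℝ :=
    ∑ b, arcCoord u b - (1 / ((n : ℝ) - 2)) • ∑ a, ∑ b, arcCoord a b with hg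
  have hgP : ∀ P : Finset (Fin (n + 1) × Fin (n + 1)), g (incVec P) =
      ∑ b, incVec P u b - P.card / ((n : ℝ) - 2) := by
    intro P
    rw [← sum_incVec P, hg]
    simp [LinearMap.sum_apply]
    ring
  have hgn : ∀ P, IsTildePath n P → P.card = n →
      g (incVec P) = -2 / ((n : ℝ) - 2) := by
    intro P hP hcard
    rw [hgP, sum_incVec_out_of_card_eq n P hP hcard u hu, hcard]
    field_simp
    ring
  have hg2 : ∀ P, IsTildePath n P → P.card = 2 →
      g (incVec P) = -2 / ((n : ℝ) - 2) + incVec P i j := by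
    intro P hP hcard
    rw [hgP, hcard]
    obtain ⟨v, hv, rfl⟩ := mem_path_of_card_eq_two n P hP hcard
    have h₁ : ∑ b, incVec {(0, v), (v, Fin.last n)} u b = if v = u then 1 else 0 := by
      simp [incVec, hu'.2, eq_comm, ite_and]
    have h₂ : incVec {(0, v), (v, Fin.last n)} i j = if v = u then 1 else 0 := by
      rcases harc with ⟨rfl, rfl⟩ | ⟨rfl, rfl⟩
      · simp [incVec, hu'.1, eq_comm]
      · simp [incVec, hu'.2, eq_comm]
    rw [h₁, h₂]
    push_cast
    ring
  obtain ⟨P₀, hP₀, hcard₀, hav₀⟩ := exists_path_avoiding_node n u hu 1 le_rfl (by omega)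
  obtain ⟨P₁, hP₁, hcard₁, hmem₁⟩ := exists_path_through_arc n i j hij (n - 1)
    (by omega) (by omega)
  obtain ⟨P₂, hP₂, hcard₂, hmem₂⟩ := exists_path_through_arc n i j hij 1
    (Or.inr ⟨le_rfl, hout⟩) (by omega)
  have hnot₀ : (i, j) ∉ P₀ := by
    intro h
    have := hav₀ _ h
    rcases huij with rfl | rfl
    · exact this.1 rfl
    · exact this.2 rfl
  have hcard₁' : P₁.card = n := by omega
  refine adim_face_add_one_ne (pathPolytope n c) {x ∈ pathPolytope n c | x i j = 0}
    (fun x hx => hx.1) (arcCoord i j) g 0 (-2 / ((n : ℝ) - 2)) (fun x hx => hx.2) ?_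
    (incVec P₀) (incVec P₁) (incVec P₂)
    (incVec_mem_pathPolytope c hP₀ (hcard₀.trans hp₂.symm))
    (incVec_mem_pathPolytope c hP₁ (hcard₁'.trans hpn.symm))
    (incVec_mem_pathPolytope c hP₂ (hcard₂.trans hp₂.symm))
    (by simp [incVec, hmem₁, hnot₀]) (by simp [incVec, hmem₁, hmem₂]) ?_ hdim
  · rintro x ⟨hx, hx0⟩
    have h₁ := le_on_pathPolytope c g (-2 / ((n : ℝ) - 2)) (by
      rintro P hP ⟨p, hp⟩
      rcases hcp p with h | h
      · rw [hg2 P hP (hp.trans h)]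
        have := incVec_nonneg P i j
        linarith
      · rw [hgn P hP (hp.trans h)]) x hx
    have h₂ := le_on_pathPolytope c (arcCoord i j - g) (2 / ((n : ℝ) - 2)) (by
      rintro P hP ⟨p, hp⟩
      rw [LinearMap.sub_apply, arcCoord_apply]
      have h₃ := incVec_nonneg P i j
      rcases hcp p with h | h
      · rw [hg2 P hP (hp.trans h)]
        apply le_of_eq
        ring
      · rw [hgn P hP (hp.trans h), neg_div]
        linarith) x hx
    rw [LinearMap.sub_apply, arcCoord_apply, hx0] at h₂
    rw [neg_div] at h₁ ⊢
    linarith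
  · rw [hgn P₁ hP₁ hcard₁', hg2 P₂ hP₂ hcard₂]
    simp [incVec, hmem₂]

/-- How a Hamiltonian path meets a directed triangle of inner nodes when `n = 4`. -/
lemma triangle_of_card_eq_four (P : Finset (Fin 5 × Fin 5)) (hP : IsTildePath 4 P)
    (hcard : P.card = 4) (i j k : Fin 5) (hi : i ∈ innerNodes 4) (hj : j ∈ innerNodes 4)
    (hk : k ∈ innerNodes 4) (hij : i ≠ j) (hik : i ≠ k) (hjk : j ≠ k) :
    ((i, j) ∉ P → ((j, k) ∈ P ↔ (k, i) ∈ P)) ∧ ¬((i, j) ∈ P ∧ (j, k) ∈ P ∧ (k, i) ∈ P) := by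
  obtain ⟨-, k', f, hf, h0, hlast, rfl⟩ := hP
  rw [Finset.card_image_of_injective _ (injective_arcs _ hf), Finset.card_univ,
    Fintype.card_fin] at hcard
  subst hcard
  have hsurj := Finite.injective_iff_surjective.1 hf
  have hin : ∀ t, f t ∈ innerNodes 4 → t.val ≠ 0 ∧ t.val ≠ 4 := by
    intro t ht
    rw [mem_innerNodes] at ht
    constructor
    · intro h
      exact ht.2 ((congrArg f (Fin.ext h : t = 0)).trans h0)
    · intro h
      exact ht.1 ((congrArg f (Fin.ext h : t = Fin.last 4)).trans hlast)
  obtain ⟨a, rfl⟩ := hsurj i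
  obtain ⟨b, rfl⟩ := hsurj j
  obtain ⟨d, rfl⟩ := hsurj k
  rw [mem_image_arcs f hf, mem_image_arcs f hf, mem_image_arcs f hf]
  have ha := hin a hi
  have hb := hin b hj
  have hd := hin d hk
  have h₁ : a.val ≠ b.val := fun h => hij (congrArg f (Fin.ext h))
  have h₂ : a.val ≠ d.val := fun h => hik (congrArg f (Fin.ext h))
  have h₃ : b.val ≠ d.val := fun h => hjk (congrArg f (Fin.ext h))
  have := a.isLt
  have := b.isLt
  have := d.isLt
  omega

/-- For `n = 4` and `c = (2, 4)` the nonnegativity constraints of inner arcs do not define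
facets. -/
theorem not_isFacetGE_inner_four {m : ℕ} (c : Fin m → ℕ) (hc : Set.range c = {2, 4})
    (i j : Fin 5) (hij : i ≠ j) (hi : i ∈ innerNodes 4) (hj : j ∈ innerNodes 4) :
    ¬IsFacetGE (pathPolytope 4 c) (fun x => x i j) 0 := by
  rintro ⟨-, hdim⟩
  obtain ⟨p₂, hp₂⟩ : ∃ p, c p = 2 := by
    have : (2 : ℕ) ∈ Set.range c := by simp [hc]
    exact this
  obtain ⟨p₄, hp₄⟩ : ∃ p, c p = 4 := by
    have : (4 : ℕ) ∈ Set.range c := by simp [hc]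
    exact this
  have hcp : ∀ p, c p = 2 ∨ c p = 4 := by
    intro p
    have : c p ∈ Set.range c := ⟨p, rfl⟩
    rw [hc] at this
    simpa using this
  obtain ⟨k, hk, hkl⟩ := exists_mem_avoiding (innerNodes 4) [i, j] (by
    rw [card_innerNodes 4 (by omega)]; simp)
  simp only [List.mem_cons, List.not_mem_nil, or_false, not_or] at hkl
  obtain ⟨hki, hkj⟩ := hkl
  have hL₁ : ListsIn (innerNodes 4) [i, j, k] :=
    ⟨by simp [hij, Ne.symm hki, Ne.symm hkj], by simp [hi, hj, hk]⟩
  have hL₂ : ListsIn (innerNodes 4) [k, i, j] :=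
    ⟨by simp [hij, hki, hkj], by simp [hi, hj, hk]⟩
  obtain ⟨P₀, hP₀, hcard₀, hav₀⟩ := exists_path_avoiding_node 4 i hi 1 le_rfl (by omega)
  obtain ⟨P₁, hP₁, hcard₁, -, -, hmem₁⟩ := exists_path_of_listsIn 4 _ hL₁ (by simp)
  obtain ⟨P₂, hP₂, hcard₂, -, -, hmem₂⟩ := exists_path_of_listsIn 4 _ hL₂ (by simp)
  have h₁ij := hmem₁ [0] i j [k, Fin.last 4] rfl
  have h₁jk := hmem₁ [0, i] j k [Fin.last 4] rfl
  have h₂ij := hmem₂ [0, k] i j [Fin.last 4] rfl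
  have h₂ki := hmem₂ [0] k i [j, Fin.last 4] rfl
  have tri := fun P hP hcard =>
    triangle_of_card_eq_four P hP hcard i j k hi hj hk hij (Ne.symm hki) (Ne.symm hkj)
  have h₁ki : (k, i) ∉ P₁ := fun h => (tri P₁ hP₁ hcard₁).2 ⟨h₁ij, h₁jk, h⟩
  have h₂jk : (j, k) ∉ P₂ := fun h => (tri P₂ hP₂ hcard₂).2 ⟨h₂ij, h, h₂ki⟩
  have hnot₀ : (i, j) ∉ P₀ := fun h => (hav₀ _ h).1 rfl
  have bound : ∀ P, IsTildePath 4 P → (∃ p, P.card = c p) →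
      0 ≤ incVec P i j + incVec P j k - incVec P k i ∧
      incVec P i j + incVec P j k - incVec P k i ≤ 2 * incVec P i j := by
    rintro P hP ⟨p, hp⟩
    have h0 : ∀ x ∈ innerNodes 4, x ≠ 0 := fun x hx => ((mem_innerNodes 4 x).1 hx).2
    have hlast : ∀ x ∈ innerNodes 4, x ≠ 4 := fun x hx => ((mem_innerNodes 4 x).1 hx).1
    rcases hcp p with h | h
    · obtain ⟨v, -, rfl⟩ := mem_path_of_card_eq_two 4 P hP (hp.trans h)
      simp [incVec, h0 i hi, h0 j hj, h0 k hk, hlast i hi, hlast j hj, hlast k hk]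
    · obtain ⟨h₁, h₂⟩ := tri P hP (hp.trans h)
      simp only [incVec]
      by_cases ha : (i, j) ∈ P <;> by_cases hb : (j, k) ∈ P <;>
        by_cases hd : (k, i) ∈ P <;> simp_all
      norm_num
  refine adim_face_add_one_ne (pathPolytope 4 c) {x ∈ pathPolytope 4 c | x i j = 0}
    (fun x hx => hx.1) (arcCoord i j) (arcCoord i j + arcCoord j k - arcCoord k i) 0 0
    (fun x hx => hx.2) ?_
    (incVec P₀) (incVec P₁) (incVec P₂)
    (incVec_mem_pathPolytope c hP₀ (hcard₀.trans hp₂.symm))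
    (incVec_mem_pathPolytope c hP₁ (hcard₁.trans hp₄.symm))
    (incVec_mem_pathPolytope c hP₂ (hcard₂.trans hp₄.symm))
    (by simp [incVec, h₁ij, hnot₀]) (by simp [incVec, h₁ij, h₂ij]) ?_ hdim
  · rintro x ⟨hx, hx0⟩
    have h₁ := le_on_pathPolytope c (arcCoord i j + arcCoord j k - arcCoord k i) 0
      (fun P hP hp => (bound P hP hp).1) x hx
    have h₂ := le_on_pathPolytope c
      ((2 : ℝ) • arcCoord i j - (arcCoord i j + arcCoord j k - arcCoord k i)) 0
      (fun P hP hp => by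
        have := (bound P hP hp).2
        simp only [LinearMap.sub_apply, LinearMap.add_apply, LinearMap.smul_apply,
          arcCoord_apply, smul_eq_mul]
        linarith) x hx
    simp only [LinearMap.sub_apply, LinearMap.add_apply, LinearMap.smul_apply,
      arcCoord_apply, smul_eq_mul, hx0] at h₁ h₂ ⊢
    linarith
  · simp [incVec, h₁ij, h₁jk, h₁ki, h₂ij, h₂jk, h₂ki]

/-- **Theorem 8 (nonnegativity facets).**  Let `n ≥ 4` and let `c` be a cardinality
sequence in `CS` (`m ≥ 2`, `2 ≤ c 0 < ⋯ < c (m-1) ≤ n`, `c ≠ (2,3)`).  For an arc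
`(i,j)` of `D̃_n`, the nonnegativity constraint `x_{ij} ≥ 0` defines a facet of
`P_{0,n-path}^c(D̃_n)` if and only if `c ≠ (2,n)`, or `c = (2,n)`, `n ≥ 5` and `(i,j)`
is an inner arc. -/
theorem nonnegativity_facet_pathPolytope (n m : ℕ) (hn : 4 ≤ n) (hm : 2 ≤ m)
    (c : Fin m → ℕ) (hmono : StrictMono c)
    (hc2 : ∀ p, 2 ≤ c p) (hcn : ∀ p, c p ≤ n)
    (hCS : Set.range c ≠ {2, 3})
    (i j : Fin (n + 1)) (hij : (i, j) ∈ tA n) :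
    IsFacetGE (pathPolytope n c) (fun x => x i j) 0 ↔
      (Set.range c ≠ {2, n} ∨
        (Set.range c = {2, n} ∧ 5 ≤ n ∧ i ≠ 0 ∧ j ≠ Fin.last n)) := by
  constructor
  · intro hfacet
    by_contra hcon
    simp only [not_or, not_not, not_and] at hcon
    obtain ⟨hc, hcon⟩ := hcon
    by_cases hout : i = 0 ∨ j = Fin.last n
    · exact not_isFacetGE_outer hn c hc i j hij hout hfacet
    · rw [not_or] at hout
      have hn4 : n = 4 := by
        by_contra h
        exact hout.2 (hcon hc (by omega) hout.1)
      subst hn4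
      obtain ⟨hne, hi, hj, -⟩ := (mem_tA 4 i j).1 hij
      exact not_isFacetGE_inner_four c hc i j hne (hi.resolve_left hout.1)
        (hj.resolve_left hout.2) hfacet
  · intro h
    have h01 : c ⟨0, by omega⟩ < c ⟨1, by omega⟩ := hmono (by simp)
    have h0 := hc2 ⟨0, by omega⟩
    have h1n := hcn ⟨1, by omega⟩
    by_cases h3 : 3 ≤ c ⟨0, by omega⟩
    · exact isFacetGE_of_two_lengths hn c i j hij (c ⟨0, by omega⟩ - 1) (c ⟨1, by omega⟩ - 1)
        (by omega) (by omega) (by omega) (by omega) ⟨⟨0, by omega⟩, by omega⟩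
        ⟨⟨1, by omega⟩, by omega⟩ (fun h => by omega)
    have h02 : c ⟨0, by omega⟩ = 2 := by omega
    by_cases hm3 : 3 ≤ m
    · have h12 : c ⟨1, by omega⟩ < c ⟨2, by omega⟩ := hmono (by simp)
      have h2n := hcn ⟨2, by omega⟩
      exact isFacetGE_of_two_lengths hn c i j hij (c ⟨1, by omega⟩ - 1) (c ⟨2, by omega⟩ - 1)
        (by omega) (by omega) (by omega) (by omega) ⟨⟨1, by omega⟩, by omega⟩
        ⟨⟨2, by omega⟩, by omega⟩ (fun h => by omega)
    obtain rfl : m = 2 := by omega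
    have hrange : Set.range c = {2, c 1} := by
      ext x
      simp only [Set.mem_range, Fin.exists_fin_two, Set.mem_insert_iff, Set.mem_singleton_iff]
      change c 0 = 2 at h02
      rw [h02, eq_comm, @eq_comm _ (c 1)]
    change c 0 < c 1 at h01
    change c 1 ≤ n at h1n
    change c 0 = 2 at h02
    have h13 : c 1 ≠ 3 := fun h => hCS (by rw [hrange, h])
    refine isFacetGE_of_two_lengths hn c i j hij 1 (c 1 - 1) le_rfl (by omega) (by omega)
      (by omega) ⟨0, by omega⟩ ⟨1, by omega⟩ fun _ => ?_
    rcases h with h | ⟨-, h5, hi, hj⟩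
    · have h1 : c 1 ≠ n := fun h' => h (by rw [hrange, h'])
      exact Or.inr (by omega)
    · exact Or.inl ⟨hi, hj, h5⟩
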